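/- arXiv:1311.6903 — 5 statements merged into one kernel-verified Lean document; each statement's English description precedes it below -/
import Mathlib

section
/- Let S_1, S_2, ..., S_r be finite simple groups. Then the minimal faithful permutation degree of their direct product equals the sum of their minimal faithful permutation degrees: μ(S_1 × S_2 × ... × S_r) = μ(S_1) + μ(S_2) + ... + μ(S_r). -/
/-- `μ G`, the minimal degree of a faithful permutation representation of `G`:
the least `n` such that `G` embeds into the symmetric group `Sym_n`. -/
noncomputable def minFaithfulDegree (G : Type*) [Group G] : ℕ :=
  sInf {n : ℕ | ∃ f : G →* Equiv.Perm (Fin n), Function.Injective f}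

section MinFaithfulDegree

variable {G : Type*} [Group G]

theorem minFaithfulDegree_le_card_of_injective {X : Type*} [Finite X]
    (f : G →* Equiv.Perm X) (hf : Function.Injective f) :
    minFaithfulDegree G ≤ Nat.card X := by
  let e := Equiv.permCongrHom (Finite.equivFin X)
  exact Nat.sInf_le ⟨e.toMonoidHom.comp f, e.injective.comp hf⟩

theorem minFaithfulDegree_le_card [Finite G] : minFaithfulDegree G ≤ Nat.card G :=
  minFaithfulDegree_le_card_of_injective (MulAction.toPermHom G G) MulAction.toPerm_injective

theorem exists_injective_perm_minFaithfulDegree (G : Type*) [Group G] [Finite G] :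
    ∃ f : G →* Equiv.Perm (Fin (minFaithfulDegree G)), Function.Injective f := by
  let e := Equiv.permCongrHom (Finite.equivFin G)
  exact Nat.sInf_mem (s := {n : ℕ | ∃ f : G →* Equiv.Perm (Fin n), Function.Injective f})
    ⟨Nat.card G, e.toMonoidHom.comp (MulAction.toPermHom G G),
      e.injective.comp MulAction.toPerm_injective⟩

variable [Finite G] [IsSimpleGroup G]

theorem minFaithfulDegree_le_index {K : Subgroup G} (hK : K ≠ ⊤) :
    minFaithfulDegree G ≤ K.index := by
  refine minFaithfulDegree_le_card_of_injective (MulAction.toPermHom G (G ⧸ K)) ?_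
  rw [← MonoidHom.ker_eq_bot_iff, ← Subgroup.normalCore_eq_ker]
  exact K.normalCore_normal.eq_bot_or_eq_top.resolve_right fun h =>
    hK (top_le_iff.1 (h ▸ K.normalCore_le))

theorem two_mul_minFaithfulDegree_le_card (hG : ¬ ∀ a b : G, a * b = b * a) :
    2 * minFaithfulDegree G ≤ Nat.card G := by
  obtain ⟨g, hg⟩ := exists_ne (1 : G)
  have htop : Subgroup.zpowers g ≠ ⊤ := by
    intro h
    refine hG fun a b => ?_
    obtain ⟨m, rfl⟩ := Subgroup.mem_zpowers_iff.1 (h ▸ Subgroup.mem_top a)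
    obtain ⟨n, rfl⟩ := Subgroup.mem_zpowers_iff.1 (h ▸ Subgroup.mem_top b)
    exact zpow_mul_comm g m n
  rw [← (Subgroup.zpowers g).card_mul_index]
  refine Nat.mul_le_mul ?_ (minFaithfulDegree_le_index htop)
  exact (Subgroup.one_lt_card_iff_ne_bot _).2 (Subgroup.zpowers_ne_bot.2 hg)

end MinFaithfulDegree

section Simple

variable {G : Type*} [Group G] [IsSimpleGroup G]

theorem IsSimpleGroup.eq_one_of_forall_commute (hG : ¬ ∀ a b : G, a * b = b * a) {z : G}
    (hz : ∀ s, s * z = z * s) : z = 1 := by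
  rcases (inferInstance : (Subgroup.center G).Normal).eq_bot_or_eq_top with h | h
  · exact Subgroup.mem_bot.1 (h ▸ Subgroup.mem_center_iff.2 hz)
  · exact absurd (fun a b => Subgroup.mem_center_iff.1 (h ▸ Subgroup.mem_top b) a) hG

theorem IsSimpleGroup.eq_top_of_commutatorElement_mem (hG : ¬ ∀ a b : G, a * b = b * a)
    {K : Subgroup G} (hK : ∀ a b : G, a * b * a⁻¹ * b⁻¹ ∈ K) : K = ⊤ := by
  have hle : commutator G ≤ K := Subgroup.commutator_le.2 fun a _ b _ => hK a b
  rcases (inferInstance : (commutator G).Normal).eq_bot_or_eq_top with h | h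
  · refine absurd (fun a b => ?_) hG
    exact commutatorElement_eq_one_iff_mul_comm.1
      (Subgroup.mem_bot.1 (h ▸ Subgroup.commutator_mem_commutator trivial trivial))
  · exact top_le_iff.1 (h ▸ hle)

end Simple

section PrimeFactorSum

/-- The sum of the prime factors of `n`, counted with multiplicity. -/
def primeFactorSum (n : ℕ) : ℕ := n.primeFactorsList.sum

theorem primeFactorSum_one : primeFactorSum 1 = 0 := by simp [primeFactorSum]

theorem primeFactorSum_prime {p : ℕ} (hp : p.Prime) : primeFactorSum p = p := by
  simp [primeFactorSum, Nat.primeFactorsList_prime hp]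

theorem primeFactorSum_mul {a b : ℕ} (ha : a ≠ 0) (hb : b ≠ 0) :
    primeFactorSum (a * b) = primeFactorSum a + primeFactorSum b := by
  simp [primeFactorSum, (Nat.perm_primeFactorsList_mul ha hb).sum_eq]

theorem primeFactorSum_le_of_dvd {a b : ℕ} (hb : b ≠ 0) (h : a ∣ b) :
    primeFactorSum a ≤ primeFactorSum b := by
  obtain ⟨c, rfl⟩ := h
  rw [primeFactorSum_mul (left_ne_zero_of_mul hb) (right_ne_zero_of_mul hb)]
  exact Nat.le_add_right _ _

theorem primeFactorSum_prod {ι : Type*} (s : Finset ι) (f : ι → ℕ) (hf : ∀ i ∈ s, f i ≠ 0) :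
    primeFactorSum (∏ i ∈ s, f i) = ∑ i ∈ s, primeFactorSum (f i) := by
  classical
  induction s using Finset.induction_on with
  | empty => simp [primeFactorSum_one]
  | insert a s ha ih =>
    rw [Finset.prod_insert ha, Finset.sum_insert ha, primeFactorSum_mul (hf _ (by simp))
      (Finset.prod_ne_zero_iff.2 fun i hi => hf i (by simp [hi])),
      ih fun i hi => hf i (by simp [hi])]

theorem primeFactorSum_le {n : ℕ} (hn : n ≠ 0) : primeFactorSum n ≤ n := by
  induction n using Nat.recOnMul with
  | zero => exact absurd rfl hn
  | one => simp [primeFactorSum_one]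
  | prime p hp => exact (primeFactorSum_prime hp).le
  | mul a b iha ihb =>
    have ha := left_ne_zero_of_mul hn
    have hb := right_ne_zero_of_mul hn
    rcases eq_or_ne a 1 with rfl | ha1
    · simpa using ihb hb
    rcases eq_or_ne b 1 with rfl | hb1
    · simpa using iha ha
    rw [primeFactorSum_mul ha hb]
    exact (Nat.add_le_add (iha ha) (ihb hb)).trans
      (Nat.add_le_mul (by omega) (by omega))

end PrimeFactorSum

theorem Subgroup.relIndex_mul_relIndex_sup_le {G : Type*} [Group G] [Finite G]
    {H K A B : Subgroup G} (hH : H ≤ K) (hA : A ≤ K) (hB : B ≤ K) :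
    H.relIndex A * (H ⊔ A).relIndex B ≤ H.relIndex K := by
  rw [← Subgroup.relIndex_mul_relIndex H (H ⊔ A) K le_sup_left (sup_le hH hA)]
  exact Nat.mul_le_mul (Subgroup.relIndex_le_of_le_right le_sup_right Subgroup.index_ne_zero_of_finite)
    (Subgroup.relIndex_le_of_le_right hB Subgroup.index_ne_zero_of_finite)

theorem Subgroup.two_le_relIndex {G : Type*} [Group G] [Finite G] {H K : Subgroup G}
    (h : ¬ K ≤ H) : 2 ≤ H.relIndex K := by
  have h0 : H.relIndex K ≠ 0 := Subgroup.index_ne_zero_of_finite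
  have h1 : H.relIndex K ≠ 1 := fun e => h (Subgroup.relIndex_eq_one.1 e)
  omega

section Pi

variable {ι : Type*} [DecidableEq ι] (S : ι → Type*) [∀ i, Group (S i)]

/-- The subgroup of a product of groups formed by the elements supported in `J`. -/
def piSupported (J : Finset ι) : Subgroup (∀ i, S i) :=
  Subgroup.pi Set.univ fun i => if i ∈ J then ⊤ else ⊥

variable {S}

theorem mem_piSupported {J : Finset ι} {f : ∀ i, S i} :
    f ∈ piSupported S J ↔ ∀ i ∉ J, f i = 1 := by
  rw [piSupported, Subgroup.mem_pi]
  refine forall_congr' fun i => ?_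
  by_cases hi : i ∈ J <;> simp [hi]

instance piSupported_normal (J : Finset ι) : (piSupported S J).Normal :=
  ⟨fun f hf g => mem_piSupported.2 fun i hi => by simp [mem_piSupported.1 hf i hi]⟩

theorem piSupported_mono {I J : Finset ι} (h : I ⊆ J) : piSupported S I ≤ piSupported S J :=
  fun _ hf => mem_piSupported.2 fun i hi => mem_piSupported.1 hf i fun hi' => hi (h hi')

theorem card_piSupported [Fintype ι] (J : Finset ι) :
    Nat.card (piSupported S J) = ∏ i ∈ J, Nat.card (S i) := by
  have h : Nat.card (piSupported S J) =
      Nat.card (∀ i, (if i ∈ J then ⊤ else ⊥ : Subgroup (S i))) :=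
    Nat.card_congr (Equiv.Set.univPi _)
  rw [h, Nat.card_pi, ← Finset.prod_subset (Finset.subset_univ J)]
  · exact Finset.prod_congr rfl fun i hi => by rw [if_pos hi, Subgroup.card_top]
  · exact fun i _ hi => by rw [if_neg hi, Subgroup.card_bot]

theorem range_mulSingle (i : ι) : (MonoidHom.mulSingle S i).range = piSupported S {i} := by
  ext f
  rw [mem_piSupported]
  constructor
  · rintro ⟨s, rfl⟩ j hj
    exact Pi.mulSingle_eq_of_ne (by simpa using hj) s
  · intro hf
    refine ⟨f i, funext fun j => ?_⟩
    by_cases hj : j = i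
    · subst hj; simp
    · simp [hj, hf j (by simpa using hj)]

theorem relIndex_piSupported_singleton (H : Subgroup (∀ i, S i)) (i : ι) :
    H.relIndex (piSupported S {i}) = (H.comap (MonoidHom.mulSingle S i)).index := by
  rw [Subgroup.index_comap, range_mulSingle]

theorem piSupported_singleton_le_iff {H : Subgroup (∀ i, S i)} {i : ι} :
    piSupported S {i} ≤ H ↔ H.comap (MonoidHom.mulSingle S i) = ⊤ := by
  rw [← range_mulSingle, MonoidHom.range_eq_map, Subgroup.map_le_iff_le_comap, top_le_iff]

theorem exists_mem_of_piSupported_le_sup {H : Subgroup (∀ i, S i)} {i : ι} {A : Finset ι}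
    (hi : i ∉ A) (h : piSupported S {i} ≤ H ⊔ piSupported S A) (s : S i) :
    ∃ x ∈ H, x i = s ∧ ∀ j ∉ A, j ≠ i → x j = 1 := by
  have hs : Pi.mulSingle i s ∈ H ⊔ piSupported S A :=
    h (range_mulSingle (S := S) i ▸ ⟨s, rfl⟩)
  obtain ⟨x, hx, a, ha, hxa⟩ := Subgroup.mem_sup_of_normal_right.1 hs
  have key : ∀ j ∉ A, x j = (Pi.mulSingle i s : ∀ i, S i) j := fun j hj => by
    simp [← hxa, mem_piSupported.1 ha j hj]
  exact ⟨x, hx, by simp [key i hi], fun j hj hji => by simp [key j hj, hji]⟩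

/-- A subgroup projecting onto a simple factor it does not contain meets that factor trivially. -/
theorem eq_one_of_mem_of_supported_singleton {H : Subgroup (∀ i, S i)} {i : ι}
    [IsSimpleGroup (S i)] (hsurj : ∀ s, ∃ x ∈ H, x i = s) (hH : ¬ piSupported S {i} ≤ H)
    {s : S i} (hs : Pi.mulSingle i s ∈ H) : s = 1 := by
  have hn : (H.comap (MonoidHom.mulSingle S i)).Normal := by
    refine ⟨fun s hs t => ?_⟩
    obtain ⟨x, hx, rfl⟩ := hsurj t
    have := H.mul_mem (H.mul_mem hx hs) (H.inv_mem hx)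
    rw [Subgroup.mem_comap]
    convert this using 1
    ext j
    by_cases hj : j = i
    · subst hj; simp
    · simp [hj]
  rw [piSupported_singleton_le_iff] at hH
  exact Subgroup.mem_bot.1 (hn.eq_bot_or_eq_top.resolve_right hH ▸ hs)

variable [∀ i, IsSimpleGroup (S i)]

/-- Suppose a subgroup `H` of a product of simple groups contains neither of the factors `i` and
`j`, projects onto the nonabelian factor `i`, and its elements supported on these two factors
project onto the factor `j`. Then the projection of `H` to the product of these two factors
contains neither of them. -/
theorem not_piSupported_le_sup_of_diagonal {H : Subgroup (∀ i, S i)} {i j : ι} {A : Finset ι}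
    (hij : i ≠ j) (hiA : i ∉ A) (hjA : j ∉ A) (hab : ¬ ∀ a b : S i, a * b = b * a)
    (hsi : ∀ s, ∃ x ∈ H, x i = s)
    (hi : ¬ piSupported S {i} ≤ H) (hj : ¬ piSupported S {j} ≤ H)
    (hd : ∀ t, ∃ x ∈ H, x j = t ∧ ∀ k, k ≠ i → k ≠ j → x k = 1) :
    ∀ k ∈ ({i, j} : Finset ι), ¬ piSupported S {k} ≤ H ⊔ piSupported S A := by
  have key : ¬ ∀ s, ∃ x ∈ H, x i = s ∧ x j = 1 := by
    intro h
    obtain ⟨t, ht⟩ := exists_ne (1 : S j)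
    obtain ⟨d, hdH, rfl, hd1⟩ := hd t
    have hdi : d i = 1 := by
      refine IsSimpleGroup.eq_one_of_forall_commute hab fun s => ?_
      obtain ⟨x, hx, rfl, hxj⟩ := h s
      have hc : Pi.mulSingle i (x i * d i * (x i)⁻¹ * (d i)⁻¹) ∈ H := by
        have := H.mul_mem (H.mul_mem (H.mul_mem hx hdH) (H.inv_mem hx)) (H.inv_mem hdH)
        convert this using 1
        ext k
        by_cases hki : k = i
        · subst hki; simp
        by_cases hkj : k = j
        · subst hkj; simp [hki, hxj]
        · simp [hki, hd1 k hki hkj]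
      exact mul_inv_eq_iff_eq_mul.1
        (mul_inv_eq_one.1 (eq_one_of_mem_of_supported_singleton hsi hi hc))
    refine ht (eq_one_of_mem_of_supported_singleton
      (fun t => (hd t).imp fun x hx => ⟨hx.1, hx.2.1⟩) hj (s := d j) ?_)
    convert hdH using 1
    ext k
    by_cases hkj : k = j
    · subst hkj; simp
    by_cases hki : k = i
    · subst hki; simp [hkj, hdi]
    · simp [hkj, hd1 k hki hkj]
  intro k hk hle
  rcases (by simpa using hk : k = i ∨ k = j) with rfl | rfl
  · refine key fun s => ?_
    obtain ⟨x, hx, hxs, hx1⟩ := exists_mem_of_piSupported_le_sup hiA hle s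
    exact ⟨x, hx, hxs, hx1 j hjA hij.symm⟩
  · refine key fun s => ?_
    obtain ⟨x, hx, hxs⟩ := hsi s
    obtain ⟨y, hy, hyx, hy1⟩ := exists_mem_of_piSupported_le_sup hjA hle (x k)
    exact ⟨x * y⁻¹, H.mul_mem hx (H.inv_mem hy), by simp [hxs, hy1 i hiA hij], by simp [hyx]⟩

variable [∀ i, Finite (S i)]

theorem minFaithfulDegree_le_relIndex_piSupported {H : Subgroup (∀ i, S i)} {i : ι}
    (hH : ¬ piSupported S {i} ≤ H) :
    minFaithfulDegree (S i) ≤ H.relIndex (piSupported S {i}) := by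
  rw [relIndex_piSupported_singleton]
  exact minFaithfulDegree_le_index fun h => hH (piSupported_singleton_le_iff.2 h)

variable [Fintype ι]

theorem card_le_relIndex_piSupported {H : Subgroup (∀ i, S i)} {i : ι} {J : Finset ι} (hi : i ∈ J)
    (hsurj : ∀ s, ∃ x ∈ H, x i = s) (hH : ¬ piSupported S {i} ≤ H) :
    Nat.card (S i) ≤ H.relIndex (piSupported S J) := by
  have hbot : H.comap (MonoidHom.mulSingle S i) = ⊥ :=
    (Subgroup.eq_bot_iff_forall _).2 fun s hs => eq_one_of_mem_of_supported_singleton hsurj hH hs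
  rw [← Subgroup.index_bot, ← hbot, ← relIndex_piSupported_singleton]
  exact Subgroup.relIndex_le_of_le_right (piSupported_mono (by simpa using hi))
    Subgroup.index_ne_zero_of_finite

theorem sum_minFaithfulDegree_le_relIndex (J : Finset ι)
    (hab : ∀ k ∈ J, ¬ ∀ a b : S k, a * b = b * a) (H : Subgroup (∀ i, S i))
    (hH : ∀ k ∈ J, ¬ piSupported S {k} ≤ H) :
    ∑ k ∈ J, minFaithfulDegree (S k) ≤ H.relIndex (piSupported S J) := by
  induction J using Finset.strongInduction generalizing H with
  | H J ih =>
  wlog hHJ : H ≤ piSupported S J generalizing H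
  · rw [← Subgroup.inf_relIndex_right]
    exact this _ (fun k hk h => hH k hk (h.trans inf_le_left)) inf_le_right
  have split : ∀ A ⊆ J, A.Nonempty → A ≠ J →
      (∀ k ∈ J \ A, ¬ piSupported S {k} ≤ H ⊔ piSupported S A) →
      ∑ k ∈ J, minFaithfulDegree (S k) ≤ H.relIndex (piSupported S J) := by
    intro A hA hne hAJ hsup
    obtain ⟨a, ha⟩ := hne
    obtain ⟨b, hb⟩ := Finset.sdiff_nonempty.2 fun h => hAJ (hA.antisymm h)
    refine le_trans ?_ (Subgroup.relIndex_mul_relIndex_sup_le hHJ (piSupported_mono hA)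
      (piSupported_mono (Finset.sdiff_subset (s := J) (t := A))))
    rw [← Finset.sum_sdiff hA, add_comm]
    refine (Nat.add_le_add (ih A (hA.ssubset_of_ne hAJ) (fun k hk => hab k (hA hk)) H
      fun k hk => hH k (hA hk)) (ih (J \ A) (Finset.sdiff_ssubset hA ⟨a, ha⟩)
      (fun k hk => hab k (Finset.mem_sdiff.1 hk).1) _ hsup)).trans
      (Nat.add_le_mul (Subgroup.two_le_relIndex fun h => hH a (hA ha) ?_)
      (Subgroup.two_le_relIndex fun h => hsup b hb ?_))
    · exact (piSupported_mono (by simpa using ha)).trans h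
    · exact (piSupported_mono (Finset.singleton_subset_iff.2 hb)).trans h
  rcases J.eq_empty_or_nonempty with rfl | ⟨i, hi⟩
  · simp
  by_cases hJi : J = {i}
  · subst hJi
    simpa using minFaithfulDegree_le_relIndex_piSupported (hH i hi)
  by_cases hsub : ∃ k ∈ J, ¬ piSupported S {k} ≤ H ⊔ piSupported S (J.erase k)
  · obtain ⟨k, hk, hle⟩ := hsub
    refine split (J.erase k) (Finset.erase_subset _ _) ?_ (Finset.erase_ne_self.2 hk) ?_
    · exact (Finset.erase_nonempty hk).2 ((Finset.nontrivial_iff_ne_singleton hi).2 hJi)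
    · simpa [Finset.sdiff_erase_self hk] using hle
  push Not at hsub
  have hsurj : ∀ k ∈ J, ∀ s, ∃ x ∈ H, x k = s := fun k hk s =>
    (exists_mem_of_piSupported_le_sup (Finset.notMem_erase k J) (hsub k hk) s).imp
      fun x hx => ⟨hx.1, hx.2.1⟩
  by_cases hi1 : ∀ k ∈ J \ {i}, ¬ piSupported S {k} ≤ H ⊔ piSupported S {i}
  · exact split {i} (by simpa using hi) (by simp) (Ne.symm hJi) hi1
  push Not at hi1
  obtain ⟨j, hj, hle⟩ := hi1
  obtain ⟨hjJ, hji⟩ : j ∈ J ∧ j ≠ i := by simpa using hj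
  have hijJ : {i, j} ⊆ J := by simp [Finset.insert_subset_iff, hi, hjJ]
  by_cases hJij : J = {i, j}
  · have h1 := card_le_relIndex_piSupported hi (hsurj i hi) (hH i hi)
    have h2 := card_le_relIndex_piSupported hjJ (hsurj j hjJ) (hH j hjJ)
    have h3 := two_mul_minFaithfulDegree_le_card (hab i hi)
    have h4 := two_mul_minFaithfulDegree_le_card (hab j hjJ)
    have h5 : ∑ k ∈ J, minFaithfulDegree (S k) =
        minFaithfulDegree (S i) + minFaithfulDegree (S j) := by
      rw [hJij, Finset.sum_pair hji.symm]
    omega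
  refine split (J \ {i, j}) Finset.sdiff_subset
    (Finset.sdiff_nonempty.2 fun h => hJij (h.antisymm hijJ)) (fun h => ?_) ?_
  · exact (Finset.mem_sdiff.1 (h ▸ hi)).2 (by simp)
  · rw [Finset.sdiff_sdiff_eq_self hijJ]
    refine not_piSupported_le_sup_of_diagonal hji.symm (by simp) (by simp) (hab i hi)
      (hsurj i hi) (hH i hi) (hH j hjJ) fun t => ?_
    obtain ⟨x, hx, hxt, hx1⟩ := exists_mem_of_piSupported_le_sup (by simpa using hji) hle t
    exact ⟨x, hx, hxt, fun k hki hkj => hx1 k (by simpa using hki) hkj⟩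

open scoped Classical in
/-- A lower bound for the size of a transitive action with point stabilizer `H`. -/
theorem primeFactorSum_add_sum_le_index {A : Finset ι}
    (hA : ∀ i, i ∈ A ↔ ∀ a b : S i, a * b = b * a) (H : Subgroup (∀ i, S i)) :
    primeFactorSum (H.relIndex (piSupported S A)) +
      ∑ k ∈ Aᶜ with ¬ piSupported S {k} ≤ H, minFaithfulDegree (S k) ≤ H.index := by
  set J : Finset ι := {k ∈ Aᶜ | ¬ piSupported S {k} ≤ H} with hJ
  have hab : ∀ k ∈ J, ¬ ∀ a b : S k, a * b = b * a := fun k hk => by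
    rw [← hA]; simpa using (Finset.mem_filter.1 hk).1
  have hJH : ∀ k ∈ J, ¬ piSupported S {k} ≤ H := fun k hk => (Finset.mem_filter.1 hk).2
  have hle : ∀ K : Subgroup (∀ i, S i), H.relIndex K ≤ H.index := fun K => by
    rw [← Subgroup.relIndex_top_right]
    exact Subgroup.relIndex_le_of_le_right le_top Subgroup.index_ne_zero_of_finite
  have hsum := sum_minFaithfulDegree_le_relIndex J hab H hJH
  by_cases hAH : piSupported S A ≤ H
  · rw [Subgroup.relIndex_eq_one.2 hAH, primeFactorSum_one, zero_add]
    exact hsum.trans (hle _)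
  have hprime := primeFactorSum_le (n := H.relIndex (piSupported S A))
    Subgroup.index_ne_zero_of_finite
  rcases J.eq_empty_or_nonempty with hJe | ⟨j, hj⟩
  · rw [hJe, Finset.sum_empty, add_zero]
    exact hprime.trans (hle _)
  have hsup : ∀ k ∈ J, ¬ piSupported S {k} ≤ H ⊔ piSupported S A := by
    intro k hk hle
    have hkA : k ∉ A := by simpa using (Finset.mem_filter.1 hk).1
    refine hJH k hk (piSupported_singleton_le_iff.2
      (IsSimpleGroup.eq_top_of_commutatorElement_mem (hab k hk) fun a b => ?_))
    obtain ⟨x, hx, rfl, hx1⟩ := exists_mem_of_piSupported_le_sup hkA hle a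
    obtain ⟨y, hy, rfl, hy1⟩ := exists_mem_of_piSupported_le_sup hkA hle b
    have := H.mul_mem (H.mul_mem (H.mul_mem hx hy) (H.inv_mem hx)) (H.inv_mem hy)
    rw [Subgroup.mem_comap]
    convert this using 1
    ext l
    by_cases hlk : l = k
    · subst hlk; simp
    by_cases hlA : l ∈ A
    · simp [hlk, (hA l).1 hlA (x l) (y l)]
    · simp [hlk, hx1 l hlA hlk, hy1 l hlA hlk]
  have hJ2 : ¬ piSupported S J ≤ H ⊔ piSupported S A := fun h =>
    hsup j hj ((piSupported_mono (by simpa using hj)).trans h)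
  rw [← Subgroup.relIndex_top_right]
  refine le_trans ?_ (Subgroup.relIndex_mul_relIndex_sup_le le_top le_top (B := piSupported S J)
    (A := piSupported S A) le_top)
  exact (Nat.add_le_add hprime (sum_minFaithfulDegree_le_relIndex J hab _ hsup)).trans
    (Nat.add_le_mul (Subgroup.two_le_relIndex hAH) (Subgroup.two_le_relIndex hJ2))

theorem sum_minFaithfulDegree_le_card {X : Type*} [Finite X] (f : (∀ i, S i) →* Equiv.Perm X)
    (hf : Function.Injective f) : ∑ i, minFaithfulDegree (S i) ≤ Nat.card X := by
  classical
  let _ : MulAction (∀ i, S i) X := MulAction.compHom X f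
  have hsmul : ∀ (g : ∀ i, S i) (x : X), g • x = f g x := fun _ _ => rfl
  let Ω := Quotient (MulAction.orbitRel (∀ i, S i) X)
  have : Fintype Ω := Fintype.ofFinite Ω
  let H : Ω → Subgroup (∀ i, S i) := fun ω => MulAction.stabilizer (∀ i, S i) ω.out
  let A : Finset ι := {i | ∀ a b : S i, a * b = b * a}
  have hA : ∀ i, i ∈ A ↔ ∀ a b : S i, a * b = b * a := fun i => by simp [A]
  have hcard : Nat.card X = ∑ ω, (H ω).index := by
    rw [Nat.card_congr (MulAction.selfEquivSigmaOrbitsQuotientStabilizer (∀ i, S i) X),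
      Nat.card_sigma]
    rfl
  have hnormal : ∀ K : Subgroup (∀ i, S i), K.Normal → (∀ ω, K ≤ H ω) → K = ⊥ := by
    refine fun K hK h => (Subgroup.eq_bot_iff_forall _).2 fun g hg => hf ?_
    ext x
    rw [map_one, Equiv.Perm.one_apply, ← hsmul]
    obtain ⟨y, hy⟩ : ∃ y : ∀ i, S i, y • (⟦x⟧ : Ω).out = x := by
      have := Quotient.exact (Quotient.out_eq (⟦x⟧ : Ω))
      exact (MulAction.orbitRel _ X).symm this
    have hst : (y⁻¹ * g * y) • (⟦x⟧ : Ω).out = (⟦x⟧ : Ω).out := by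
      have := h ⟦x⟧ (hK.conj_mem g hg y⁻¹)
      rwa [inv_inv] at this
    rw [mul_smul, hy, mul_smul, inv_smul_eq_iff, hy] at hst
    exact hst
  have hcomm : ∀ x ∈ piSupported S A, ∀ y, x * y = y * x := by
    intro x hx y
    ext i
    by_cases hi : i ∈ A
    · exact (hA i).1 hi _ _
    · simp [mem_piSupported.1 hx i hi]
  have hdvd : Nat.card (piSupported S A) ∣ ∏ ω, (H ω).relIndex (piSupported S A) := by
    have hn : ∀ ω, ((H ω).subgroupOf (piSupported S A)).Normal := fun ω =>
      ⟨fun x hx y => by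
        have : y * x * y⁻¹ = x := by
          rw [mul_inv_eq_iff_eq_mul]
          exact Subtype.ext (hcomm y y.2 x)
        rwa [this]⟩
    have h := Subgroup.card_dvd_of_injective
      (MonoidHom.pi fun ω => QuotientGroup.mk' ((H ω).subgroupOf (piSupported S A))) ?_
    · rwa [Nat.card_pi] at h
    · refine (injective_iff_map_eq_one _).2 fun x hx => ?_
      have hxH : ∀ ω, (x : ∀ i, S i) ∈ H ω := fun ω =>
        Subgroup.mem_subgroupOf.1 ((QuotientGroup.eq_one_iff x).1 (congrFun hx ω))
      have hbot := hnormal (piSupported S A ⊓ ⨅ ω, H ω)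
        ⟨fun y hy g => by rwa [← hcomm y hy.1 g, mul_inv_cancel_right]⟩
        fun ω => inf_le_right.trans (iInf_le _ ω)
      exact Subtype.ext (Subgroup.mem_bot.1 (hbot ▸ ⟨x.2, Subgroup.mem_iInf.2 hxH⟩))
  have habelian : ∑ i ∈ A, minFaithfulDegree (S i) ≤
      ∑ ω, primeFactorSum ((H ω).relIndex (piSupported S A)) := by
    have hne : ∀ ω ∈ Finset.univ, (H ω).relIndex (piSupported S A) ≠ 0 := fun ω _ =>
      Subgroup.index_ne_zero_of_finite
    rw [← primeFactorSum_prod _ _ hne]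
    refine le_trans ?_ (primeFactorSum_le_of_dvd (Finset.prod_ne_zero_iff.2 hne) hdvd)
    rw [card_piSupported, primeFactorSum_prod _ _ fun i _ => Nat.card_pos.ne']
    refine Finset.sum_le_sum fun i hi => ?_
    let _ : CommGroup (S i) := { (inferInstance : Group (S i)) with mul_comm := (hA i).1 hi }
    rw [primeFactorSum_prime IsSimpleGroup.prime_card]
    exact minFaithfulDegree_le_card
  have hnonabelian : ∑ i ∈ Aᶜ, minFaithfulDegree (S i) ≤
      ∑ ω, ∑ k ∈ Aᶜ with ¬ piSupported S {k} ≤ H ω, minFaithfulDegree (S k) := by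
    simp_rw [Finset.sum_filter]
    rw [Finset.sum_comm]
    refine Finset.sum_le_sum fun k _ => ?_
    obtain ⟨ω, hω⟩ : ∃ ω, ¬ piSupported S {k} ≤ H ω := by
      by_contra! h
      have hbot := hnormal _ inferInstance h
      obtain ⟨s, hs⟩ := exists_ne (1 : S k)
      refine hs ?_
      have : Pi.mulSingle k s ∈ piSupported S {k} := range_mulSingle (S := S) k ▸ ⟨s, rfl⟩
      rw [hbot, Subgroup.mem_bot] at this
      simpa using this
    calc minFaithfulDegree (S k)
        = if ¬ piSupported S {k} ≤ H ω then minFaithfulDegree (S k) else 0 := by rw [if_pos hω]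
      _ ≤ _ := Finset.single_le_sum
        (f := fun ω => if ¬ piSupported S {k} ≤ H ω then minFaithfulDegree (S k) else 0)
        (fun _ _ => Nat.zero_le _) (Finset.mem_univ ω)
  calc ∑ i, minFaithfulDegree (S i)
      = ∑ i ∈ A, minFaithfulDegree (S i) + ∑ i ∈ Aᶜ, minFaithfulDegree (S i) :=
        (Finset.sum_add_sum_compl A _).symm
    _ ≤ _ := Nat.add_le_add habelian hnonabelian
    _ = ∑ ω, (primeFactorSum ((H ω).relIndex (piSupported S A)) +
          ∑ k ∈ Aᶜ with ¬ piSupported S {k} ≤ H ω, minFaithfulDegree (S k)) :=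
        Finset.sum_add_distrib.symm
    _ ≤ ∑ ω, (H ω).index :=
        Finset.sum_le_sum fun ω _ => primeFactorSum_add_sum_le_index hA (H ω)
    _ = Nat.card X := hcard.symm

end Pi

/-- Let `S_1, S_2, ..., S_r` be finite simple groups. Then the minimal faithful permutation
degree of their direct product equals the sum of their minimal faithful permutation
degrees: `μ(S_1 × ... × S_r) = μ(S_1) + ... + μ(S_r)`. -/
theorem minFaithfulDegree_pi_simple (r : ℕ) (S : Fin r → Type*)
    [∀ i, Group (S i)] [∀ i, Finite (S i)] [∀ i, IsSimpleGroup (S i)] :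
    minFaithfulDegree (∀ i, S i) = ∑ i, minFaithfulDegree (S i) := by
  refine le_antisymm ?_ ?_
  · choose f hf using fun i => exists_injective_perm_minFaithfulDegree (S i)
    have h := minFaithfulDegree_le_card_of_injective
      ((Equiv.Perm.sigmaCongrRightHom fun i => Fin (minFaithfulDegree (S i))).comp
        (MonoidHom.piMap f))
      (Equiv.Perm.sigmaCongrRightHom_injective.comp fun x y hxy =>
        funext fun i => hf i (congrFun hxy i))
    simpa [Nat.card_sigma] using h
  · obtain ⟨f, hf⟩ := exists_injective_perm_minFaithfulDegree (∀ i, S i)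
    simpa using sum_minFaithfulDegree_le_card f hf
end

section
/- Let p be a prime and let E be an elementary abelian p-group of order p^n acting faithfully (by automorphisms) on a finite nilpotent group Q whose order is coprime to p. Then there exists a chain of subgroups E = E_0 > E_1 > E_2 > ... > E_n = 1 such that all inclusions of fixed-point centralizers C_Q(E_0) < C_Q(E_1) < ... < C_Q(E_n) are strict. -/
/-- Given a group `E` acting by automorphisms on a group `Q` via `φ` and a subgroup
`F ≤ E`, this is `C_Q(F)`, the subgroup of elements of `Q` fixed by every element
of `F`. -/
def fixedSubgroup {E Q : Type*} [Group E] [Group Q] (φ : E →* MulAut Q)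
    (F : Subgroup E) : Subgroup Q where
  carrier := {q | ∀ e ∈ F, φ e q = q}
  one_mem' := fun e _ => map_one (φ e)
  mul_mem' := fun {a b} ha hb e he => by
    rw [map_mul, ha e he, hb e he]
  inv_mem' := fun {a} ha e he => by
    rw [map_inv, ha e he]

theorem pow_eq_one_of_coprime_natCard {G : Type*} [Group G] [Finite G] {p : ℕ}
    (hcop : Nat.Coprime (Nat.card G) p) {g : G} (hg : g ^ p = 1) : g = 1 := by
  rw [← orderOf_eq_one_iff]
  exact Nat.eq_one_of_dvd_coprimes hcop (orderOf_dvd_natCard g) (orderOf_dvd_of_pow_eq_one hg)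

section Actions

variable {E G : Type*} [Group E] [Group G]

/-- The restriction of an action by endomorphisms to an invariant subgroup. -/
def restrictAction (φ : E →* Monoid.End G) (H : Subgroup G)
    (hH : ∀ e, ∀ x ∈ H, φ e x ∈ H) : E →* Monoid.End H where
  toFun e := ((φ e : G →* G).domRestrict H).codRestrict H fun x => hH e x x.2
  map_one' := MonoidHom.ext fun x => Subtype.ext (by
    change φ 1 (x : G) = x
    rw [map_one]; rfl)
  map_mul' a b := MonoidHom.ext fun x => Subtype.ext (by
    change φ (a * b) (x : G) = φ a (φ b x)
    rw [map_mul]; rfl)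

/-- The action induced on the quotient by an invariant normal subgroup. -/
def quotientAction (φ : E →* Monoid.End G) (N : Subgroup G) [N.Normal]
    (hN : ∀ e, ∀ x ∈ N, φ e x ∈ N) : E →* Monoid.End (G ⧸ N) where
  toFun e := QuotientGroup.map N N (φ e : G →* G) (hN e)
  map_one' := by
    refine QuotientGroup.monoidHom_ext _ (MonoidHom.ext fun x => ?_)
    exact congrArg (QuotientGroup.mk (s := N)) (by rw [map_one]; rfl)
  map_mul' a b := by
    refine QuotientGroup.monoidHom_ext _ (MonoidHom.ext fun x => ?_)
    exact congrArg (QuotientGroup.mk (s := N)) (by rw [map_mul]; rfl)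

theorem quotientAction_mk (φ : E →* Monoid.End G) (N : Subgroup G) [N.Normal]
    (hN : ∀ e, ∀ x ∈ N, φ e x ∈ N) (e : E) (x : G) :
    quotientAction φ N hN e (x : G ⧸ N) = ((φ e x : G) : G ⧸ N) := rfl

theorem action_mul_apply (φ : E →* Monoid.End G) (a b : E) (g : G) :
    φ (a * b) g = φ a (φ b g) := by
  rw [map_mul]; rfl

theorem action_one_apply (φ : E →* Monoid.End G) (g : G) : φ 1 g = g := by
  rw [map_one]; rfl

theorem action_mem_center (φ : E →* Monoid.End G) (e : E) (x : G)
    (hx : x ∈ Subgroup.center G) : φ e x ∈ Subgroup.center G := by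
  rw [Subgroup.mem_center_iff] at hx ⊢
  intro g
  have hg : φ e (φ e⁻¹ g) = g := by
    rw [← action_mul_apply, mul_inv_cancel, action_one_apply]
  rw [← hg, ← map_mul, hx, map_mul]

theorem action_pow_fixed (φ : E →* Monoid.End G) {e : E} {g : G} (h : φ e g = g) (k : ℕ) :
    φ (e ^ k) g = g := by
  induction k with
  | zero => rw [pow_zero, action_one_apply]
  | succ k ih => rw [pow_succ, action_mul_apply, h, ih]

/-- An element fixed modulo a pointwise fixed subgroup of order prime to `p` is fixed by an
element of order `p`. -/
theorem action_fixed_of_inv_mul_mem [Finite G] {p : ℕ} (hcop : Nat.Coprime (Nat.card G) p)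
    (φ : E →* Monoid.End G) {e : E} (he : e ^ p = 1) {g : G}
    (h : φ e (g⁻¹ * φ e g) = g⁻¹ * φ e g) : φ e g = g := by
  set z := g⁻¹ * φ e g with hz
  have hg : φ e g = g * z := by rw [hz, mul_inv_cancel_left]
  have key : ∀ k : ℕ, φ (e ^ k) g = g * z ^ k := by
    intro k
    induction k with
    | zero => rw [pow_zero, action_one_apply, pow_zero, mul_one]
    | succ k ih =>
      rw [pow_succ, action_mul_apply, hg, map_mul, ih, action_pow_fixed φ h, pow_succ, mul_assoc]
  have hp := key p
  rw [he, action_one_apply, left_eq_mul] at hp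
  rw [hg, pow_eq_one_of_coprime_natCard hcop hp, mul_one]

end Actions

theorem prod_pow_action_fixed {E A : Type*} [Group E] [CommGroup A] (φ : E →* Monoid.End A)
    {w : E} {p : ℕ} (hw : w ^ p = 1) (a : A) :
    φ w (∏ j ∈ Finset.range p, φ (w ^ j) a) = ∏ j ∈ Finset.range p, φ (w ^ j) a := by
  rw [map_prod]
  simp only [← action_mul_apply, ← pow_succ']
  have h := (Finset.prod_range_succ' (fun j => φ (w ^ j) a) p).symm.trans
    (Finset.prod_range_succ (fun j => φ (w ^ j) a) p)
  rw [hw, pow_zero] at h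
  exact mul_right_cancel h

theorem action_trivial_of_commGroup {p : ℕ} (hp : p.Prime) {E A : Type*} [CommGroup E]
    [CommGroup A] [Finite A] (hexp : ∀ x : E, x ^ p = 1) (hcop : Nat.Coprime (Nat.card A) p)
    (φ : E →* Monoid.End A) (u v : E) (hv : ∀ a, φ v a = a → ∀ e, φ e a = a)
    (huv : ∀ (i : ℕ) (a : A), φ (u * v ^ i) a = a → ∀ e, φ e a = a) (e : E) (a : A) :
    φ e a = a := by
  have hinner : ∀ j ∈ Finset.range (p - 1), ∀ f,
      φ f (∏ i ∈ Finset.range p, φ ((v ^ (j + 1)) ^ i) a) =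
        ∏ i ∈ Finset.range p, φ ((v ^ (j + 1)) ^ i) a := by
    intro j hj
    refine hv _ ?_
    have hfix := prod_pow_action_fixed φ (hexp (v ^ (j + 1))) a
    have hlt : j + 1 < p := by have := Finset.mem_range.mp hj; omega
    have hcop' : Nat.Coprime (orderOf v) (j + 1) :=
      Nat.Coprime.coprime_dvd_left (orderOf_dvd_of_pow_eq_one (hexp v))
        (Nat.coprime_of_lt_prime (by omega) hlt hp)
    obtain ⟨m, hm⟩ := exists_pow_eq_self_of_coprime hcop'.symm
    have := action_pow_fixed φ hfix m
    rwa [hm] at this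
  have hprod : ∏ i ∈ Finset.range p, ∏ j ∈ Finset.range p, φ ((u * v ^ i) ^ j) a =
      (∏ j ∈ Finset.range (p - 1), ∏ i ∈ Finset.range p, φ ((v ^ (j + 1)) ^ i) a) * a ^ p := by
    rw [Finset.prod_comm]
    obtain ⟨q, rfl⟩ : ∃ q, p = q + 1 := ⟨p - 1, by have := hp.pos; omega⟩
    rw [Finset.prod_range_succ' _ q]
    congr 1
    · refine Finset.prod_congr rfl fun j hj => ?_
      rw [← hinner j hj (u ^ (j + 1)), map_prod]
      refine Finset.prod_congr rfl fun i _ => ?_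
      rw [← action_mul_apply, mul_pow, ← pow_mul, ← pow_mul, mul_comm i]
    · simp
  have hpow : φ e (a ^ p) = a ^ p := by
    have hlhs : φ e (∏ i ∈ Finset.range p, ∏ j ∈ Finset.range p, φ ((u * v ^ i) ^ j) a) =
        ∏ i ∈ Finset.range p, ∏ j ∈ Finset.range p, φ ((u * v ^ i) ^ j) a := by
      rw [map_prod]
      exact Finset.prod_congr rfl fun i _ =>
        huv i _ (prod_pow_action_fixed φ (hexp _) a) e
    rw [hprod, map_mul, map_prod, Finset.prod_congr rfl fun j hj => hinner j hj e] at hlhs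
    exact mul_left_cancel hlhs
  rw [← div_eq_one]
  refine pow_eq_one_of_coprime_natCard hcop ?_
  rw [div_pow, ← map_pow, hpow, div_self']

open scoped IsMulCommutative in
/-- A coprime action of an abelian group of exponent `p` on a finite nilpotent group is trivial as
soon as `v` and all `u * v ^ i` have no more fixed points than the whole group. -/
theorem action_trivial_of_isNilpotent {p : ℕ} (hp : p.Prime) {E G : Type*} [CommGroup E]
    (hexp : ∀ x : E, x ^ p = 1) (u v : E) [Group G] [Finite G] (hnilp : Group.IsNilpotent G)
    (hcop : Nat.Coprime (Nat.card G) p)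
    (φ : E →* Monoid.End G) (hv : ∀ g, φ v g = g → ∀ e, φ e g = g)
    (huv : ∀ (i : ℕ) (g : G), φ (u * v ^ i) g = g → ∀ e, φ e g = g) (e : E) (g : G) :
    φ e g = g := by
  revert hcop φ hv huv e g
  refine Group.nilpotent_center_quotient_ind (P := fun G _ _ => ∀ [Finite G],
    Nat.Coprime (Nat.card G) p → ∀ φ : E →* Monoid.End G,
    (∀ g, φ v g = g → ∀ e, φ e g = g) →
    (∀ (i : ℕ) (g : G), φ (u * v ^ i) g = g → ∀ e, φ e g = g) → ∀ e g, φ e g = g) G ?_ ?_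
  · intro G _ _ _ _ φ _ _ e g
    exact Subsingleton.elim _ _
  · intro G _ _ ih _ hcop φ hv huv e g
    have hinv := action_mem_center φ
    have hcenter : ∀ e, ∀ z ∈ Subgroup.center G, φ e z = z := by
      intro e z hz
      refine congrArg Subtype.val (action_trivial_of_commGroup hp hexp
        (hcop.coprime_dvd_left (Subgroup.card_subgroup_dvd_card _))
        (restrictAction φ (Subgroup.center G) hinv) u v ?_ ?_ e ⟨z, hz⟩)
      · exact fun a ha f => Subtype.ext (hv a (congrArg Subtype.val ha) f)
      · exact fun i a ha f => Subtype.ext (huv i a (congrArg Subtype.val ha) f)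
    have hlift : ∀ (f : E) (x : G), quotientAction φ _ hinv f (x : G ⧸ Subgroup.center G) = x →
        φ f x = x := by
      intro f x hx
      refine action_fixed_of_inv_mul_mem hcop φ (hexp f) (hcenter f _ ?_)
      exact QuotientGroup.eq.mp hx.symm
    refine hlift e g (ih (hcop.coprime_dvd_left (Subgroup.card_quotient_dvd_card _))
      (quotientAction φ _ hinv) ?_ ?_ e g)
    · intro x
      induction x using QuotientGroup.induction_on with
      | H x => exact fun hx f => by rw [quotientAction_mk, hv x (hlift _ x hx) f]
    · intro i x
      induction x using QuotientGroup.induction_on with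
      | H x => exact fun hx f => by rw [quotientAction_mk, huv i x (hlift _ x hx) f]

theorem fixedSubgroup_anti {E Q : Type*} [Group E] [Group Q] (φ : E →* MulAut Q)
    {F F' : Subgroup E} (h : F ≤ F') : fixedSubgroup φ F' ≤ fixedSubgroup φ F :=
  fun _ hq e he => hq e (h he)

theorem mem_fixedSubgroup_sup_zpowers {E Q : Type*} [Group E] [Group Q] (φ : E →* MulAut Q)
    {F : Subgroup E} {w : E} {q : Q} (hq : q ∈ fixedSubgroup φ F) (hw : φ w q = q) :
    q ∈ fixedSubgroup φ (F ⊔ Subgroup.zpowers w) := by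
  let S : Subgroup E := (MulAction.stabilizer (MulAut Q) q).comap φ
  have hS : F ⊔ Subgroup.zpowers w ≤ S :=
    sup_le (fun e he => hq e he) ((Subgroup.zpowers_le (H := S)).mpr hw)
  exact fun e he => hS he

theorem fixedSubgroup_map_subtype {E Q : Type*} [Group E] [Group Q] (φ : E →* MulAut Q)
    (F : Subgroup E) (K : Subgroup F) :
    fixedSubgroup φ (K.map F.subtype) = fixedSubgroup (φ.comp F.subtype) K := by
  ext q
  constructor
  · exact fun h e he => h _ (Subgroup.mem_map_of_mem _ he)
  · rintro h _ ⟨e, he, rfl⟩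
    exact h e he

theorem index_eq_prime_of_sup_zpowers_eq_top {p : ℕ} (hp : p.Prime) {E : Type*} [CommGroup E]
    (F : Subgroup E) {v : E} (hvp : v ^ p = 1) (hv : v ∉ F)
    (h : F ⊔ Subgroup.zpowers v = ⊤) : F.index = p := by
  have := Fact.mk hp
  have hord : orderOf (v : E ⧸ F) = p := by
    refine orderOf_eq_prime ?_ ?_
    · rw [← QuotientGroup.mk_pow, hvp, QuotientGroup.mk_one]
    · rwa [Ne, QuotientGroup.eq_one_iff]
  have htop : Subgroup.zpowers (v : E ⧸ F) = ⊤ := by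
    have := congrArg (Subgroup.map (QuotientGroup.mk' F)) h
    rwa [Subgroup.map_sup, QuotientGroup.map_mk'_self, bot_sup_eq, MonoidHom.map_zpowers,
      Subgroup.map_top_of_surjective _ (QuotientGroup.mk'_surjective F)] at this
  rw [Subgroup.index, ← hord, ← Nat.card_zpowers, htop, Subgroup.card_top]

/-- Some subgroup of index `p` has strictly more fixed points than the whole group. -/
theorem exists_index_eq_prime_fixedSubgroup_lt {p : ℕ} (hp : p.Prime) {E Q : Type*} [CommGroup E]
    [Finite E] [Nontrivial E] [Group Q] [Finite Q] (hexp : ∀ x : E, x ^ p = 1)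
    (hnilp : Group.IsNilpotent Q) (hcop : Nat.Coprime (Nat.card Q) p)
    (φ : E →* MulAut Q) (hfaithful : Function.Injective φ) :
    ∃ F : Subgroup E, F.index = p ∧ fixedSubgroup φ ⊤ < fixedSubgroup φ F := by
  have hbot : fixedSubgroup φ ⊥ ≠ fixedSubgroup φ ⊤ := by
    intro h
    obtain ⟨e, he⟩ := exists_ne (1 : E)
    refine he (hfaithful (MulEquiv.ext fun q => ?_))
    have hq : q ∈ fixedSubgroup φ ⊥ := fun f hf => by rw [Subgroup.mem_bot.mp hf, map_one]; rfl
    rw [h] at hq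
    rw [hq e trivial, map_one]; rfl
  obtain ⟨F, hF⟩ := (Set.toFinite {F | fixedSubgroup φ F ≠ fixedSubgroup φ ⊤}).exists_maximal
    ⟨⊥, hbot⟩
  have hne : fixedSubgroup φ F ≠ fixedSubgroup φ ⊤ := hF.prop
  have hlt : fixedSubgroup φ ⊤ < fixedSubgroup φ F :=
    lt_of_le_of_ne (fixedSubgroup_anti φ le_top) hne.symm
  refine ⟨F, ?_, hlt⟩
  obtain ⟨v, hv⟩ : ∃ v, v ∉ F := by
    by_contra! hall
    exact hne (by rw [(Subgroup.eq_top_iff' F).mpr hall])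
  refine index_eq_prime_of_sup_zpowers_eq_top hp F (hexp v) hv ?_
  by_contra hsup
  obtain ⟨u, hu⟩ : ∃ u, u ∉ F ⊔ Subgroup.zpowers v := by
    by_contra! hall
    exact hsup ((Subgroup.eq_top_iff' _).mpr hall)
  have hfix : ∀ w ∉ F, ∀ q ∈ fixedSubgroup φ F, φ w q = q → ∀ e, φ e q = q := by
    intro w hw q hq hwq e
    have hmem := mem_fixedSubgroup_sup_zpowers φ hq hwq
    have heq : fixedSubgroup φ (F ⊔ Subgroup.zpowers w) = fixedSubgroup φ ⊤ := by
      by_contra hne'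
      exact hw (hF.le_of_ge hne' le_sup_left (Subgroup.mem_sup_right (Subgroup.mem_zpowers w)))
    rw [heq] at hmem
    exact hmem e trivial
  have huv : ∀ i : ℕ, u * v ^ i ∉ F := by
    intro i hi
    refine hu ((Subgroup.mul_mem_cancel_right _ ?_).mp (Subgroup.mem_sup_left hi))
    exact Subgroup.mem_sup_right (Subgroup.npow_mem_zpowers v i)
  let ψ : E →* Monoid.End Q := (MulDistribMulAction.toMonoidEnd (MulAut Q) Q).comp φ
  have hinv : ∀ e, ∀ q ∈ fixedSubgroup φ F, ψ e q ∈ fixedSubgroup φ F := by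
    intro e q hq f hf
    change φ f (φ e q) = φ e q
    rw [← MulAut.mul_apply, ← map_mul, mul_comm, map_mul, MulAut.mul_apply, hq f hf]
  refine hlt.not_ge fun q hq e _ => ?_
  refine congrArg Subtype.val (action_trivial_of_isNilpotent hp hexp u v inferInstance
    (hcop.coprime_dvd_left (Subgroup.card_subgroup_dvd_card _))
    (restrictAction ψ (fixedSubgroup φ F) hinv) ?_ ?_ e ⟨q, hq⟩)
  · exact fun x hx f => Subtype.ext (hfix v hv x x.2 (congrArg Subtype.val hx) f)
  · exact fun i x hx f => Subtype.ext (hfix _ (huv i) x x.2 (congrArg Subtype.val hx) f)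

/-- Let `p` be a prime and let `E` be an elementary abelian `p`-group of order `p^n`
acting faithfully by automorphisms on a finite nilpotent group `Q` whose order is coprime
to `p`. Then there exists a chain of subgroups `E = E_0 > E_1 > ... > E_n = 1` such that
all inclusions of centralizers `C_Q(E_0) < C_Q(E_1) < ... < C_Q(E_n)` are strict. -/
theorem exists_strict_chain_of_fixedSubgroups
    (p : ℕ) (hp : p.Prime) (n : ℕ) (E Q : Type*) [CommGroup E] [Group Q] [Finite Q]
    (hexp : ∀ x : E, x ^ p = 1) (hcard : Nat.card E = p ^ n)
    (hnilp : Group.IsNilpotent Q) (hcop : Nat.Coprime (Nat.card Q) p)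
    (φ : E →* MulAut Q) (hfaithful : Function.Injective φ) :
    ∃ Es : Fin (n + 1) → Subgroup E,
      Es 0 = ⊤ ∧ Es (Fin.last n) = ⊥ ∧ StrictAnti Es ∧
        StrictMono fun i => fixedSubgroup φ (Es i) := by
  induction n generalizing E with
  | zero =>
    have : Subsingleton (Fin (0 + 1)) := Fin.subsingleton_one
    have : Subsingleton E := (Nat.card_eq_one_iff_unique.mp (by simpa using hcard)).1
    exact ⟨fun _ => ⊤, rfl, Subsingleton.elim _ _, Subsingleton.strictAnti _,
      Subsingleton.strictMono _⟩
  | succ n ih =>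
    have : Finite E := Nat.finite_of_card_ne_zero (by rw [hcard]; exact (pow_pos hp.pos _).ne')
    have : Nontrivial E := by
      rw [← Finite.one_lt_card_iff_nontrivial, hcard]
      exact Nat.one_lt_pow n.succ_ne_zero hp.one_lt
    obtain ⟨F, hindex, hlt⟩ :=
      exists_index_eq_prime_fixedSubgroup_lt hp hexp hnilp hcop φ hfaithful
    have hF : Nat.card F = p ^ n := by
      refine Nat.eq_of_mul_eq_mul_right hp.pos ?_
      rw [← pow_succ, ← hcard, ← F.card_mul_index, hindex]
    obtain ⟨Es, h0, hlast, hanti, hmono⟩ := ih F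
      (fun x => Subtype.ext (hexp x)) hF (φ.comp F.subtype)
      (hfaithful.comp F.subtype_injective)
    have h0' : (Es 0).map F.subtype = F := by
      rw [h0, ← MonoidHom.range_eq_map, Subgroup.range_subtype]
    refine ⟨Fin.cons ⊤ fun i => (Es i).map F.subtype, rfl, ?_, ?_, ?_⟩
    · rw [← Fin.succ_last, Fin.cons_succ, hlast, Subgroup.map_bot]
    · refine Fin.strictAnti_iff_succ_lt.mpr fun i => ?_
      cases i using Fin.cases with
      | zero =>
        rw [Fin.cons_succ, Fin.castSucc_zero, Fin.cons_zero, h0', lt_top_iff_ne_top]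
        rintro rfl
        exact hlt.false
      | succ i =>
        rw [Fin.cons_succ, ← Fin.succ_castSucc, Fin.cons_succ]
        exact (Subgroup.map_lt_map_iff_of_injective F.subtype_injective).mpr
          (hanti i.castSucc_lt_succ)
    · refine Fin.strictMono_iff_lt_succ.mpr fun i => ?_
      cases i using Fin.cases with
      | zero => simpa only [Fin.cons_succ, Fin.castSucc_zero, Fin.cons_zero, h0'] using hlt
      | succ i =>
        simp only [Fin.cons_succ, ← Fin.succ_castSucc, fixedSubgroup_map_subtype]
        exact hmono i.castSucc_lt_succ
end

section
/- Every locally finite nonabelian simple group contains a finite insoluble subgroup. -/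
/-- A group is locally finite if every finitely generated subgroup is finite. -/
def LocallyFiniteGroup (G : Type*) [Group G] : Prop :=
  ∀ s : Finset G, Finite (Subgroup.closure (s : Set G))

open scoped commutatorElement

/-- An element of the normal closure of `c` already lies in every subgroup containing `c` that is
stable under conjugation by a suitable finite set. -/
theorem exists_finset_mem_of_mem_normalClosure {G : Type*} [Group G] {c x : G}
    (hx : x ∈ Subgroup.normalClosure {c}) :
    ∃ s : Finset G, ∀ D : Subgroup G, c ∈ D → (∀ g ∈ s, ∀ d ∈ D, g * d * g⁻¹ ∈ D) → x ∈ D := by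
  classical
  induction hx using Subgroup.closure_induction with
  | mem x hx =>
    obtain ⟨y, rfl, hy⟩ := Group.mem_conjugatesOfSet_iff.mp hx
    obtain ⟨g, rfl⟩ := isConj_iff.mp hy
    exact ⟨{g}, fun D hc hD => hD g (Finset.mem_singleton_self g) _ hc⟩
  | one => exact ⟨∅, fun D _ _ => D.one_mem⟩
  | mul x y _ _ ihx ihy =>
    obtain ⟨s, hs⟩ := ihx
    obtain ⟨t, ht⟩ := ihy
    exact ⟨s ∪ t, fun D hc hD => D.mul_mem
      (hs D hc fun g hg => hD g (Finset.mem_union_left t hg))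
      (ht D hc fun g hg => hD g (Finset.mem_union_right s hg))⟩
  | inv x _ ih =>
    obtain ⟨s, hs⟩ := ih
    exact ⟨s, fun D hc hD => D.inv_mem (hs D hc hD)⟩

/-- If every subgroup of `K` that is normal in `K` and contains `⁅a, b⁆` also contains `a` and
`b`, and `a` and `b` do not commute, then `K` is not solvable. -/
theorem not_isSolvable_of_forall_normal {K : Type*} [Group K] {a b : K} (hab : ⁅a, b⁆ ≠ 1)
    (h : ∀ D : Subgroup K, D.Normal → ⁅a, b⁆ ∈ D → a ∈ D ∧ b ∈ D) : ¬Group.IsSolvable K := by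
  rintro ⟨n, hn⟩
  have hmem : ∀ n, ⁅a, b⁆ ∈ derivedSeries K n := by
    intro n
    induction n with
    | zero => exact Subgroup.mem_top _
    | succ n ih =>
      obtain ⟨ha, hb⟩ := h _ inferInstance ih
      exact Subgroup.commutator_mem_commutator ha hb
  exact hab (Subgroup.mem_bot.mp (hn ▸ hmem n))

/-- Every locally finite nonabelian simple group contains a finite insoluble subgroup. -/
theorem exists_finite_insoluble_subgroup (G : Type*) [Group G]
    (hlf : LocallyFiniteGroup G) (hsimple : IsSimpleGroup G)
    (hnonabelian : ∃ a b : G, a * b ≠ b * a) :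
    ∃ H : Subgroup G, Finite H ∧ ¬IsSolvable H := by
  classical
  obtain ⟨a, b, hab⟩ := hnonabelian
  have hc : ⁅a, b⁆ ≠ 1 := fun h => hab (commutatorElement_eq_one_iff_mul_comm.mp h)
  have htop : Subgroup.normalClosure {⁅a, b⁆} = ⊤ :=
    Subgroup.normalClosure_normal.eq_bot_or_eq_top.resolve_left fun h =>
      hc (Subgroup.mem_bot.mp (h ▸ Subgroup.subset_normalClosure (Set.mem_singleton _)))
  obtain ⟨s, hs⟩ := exists_finset_mem_of_mem_normalClosure (htop ▸ Subgroup.mem_top a)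
  obtain ⟨t, ht⟩ := exists_finset_mem_of_mem_normalClosure (htop ▸ Subgroup.mem_top b)
  let u : Finset G := {a, b} ∪ (s ∪ t)
  have hu : ∀ g ∈ u, g ∈ Subgroup.closure (u : Set G) := fun g hg => Subgroup.subset_closure hg
  refine ⟨Subgroup.closure (u : Set G), hlf u, ?_⟩
  refine not_isSolvable_of_forall_normal (a := ⟨a, hu a (by simp [u])⟩)
    (b := ⟨b, hu b (by simp [u])⟩) (fun h => hc (congrArg Subtype.val h)) fun D hD hcD => ?_
  have hconj : ∀ g ∈ u, ∀ d ∈ D.map (Subgroup.closure (u : Set G)).subtype,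
      g * d * g⁻¹ ∈ D.map (Subgroup.closure (u : Set G)).subtype := by
    rintro g hg _ ⟨d, hd, rfl⟩
    exact ⟨_, hD.conj_mem d hd ⟨g, hu g hg⟩, rfl⟩
  have hcD' : ⁅a, b⁆ ∈ D.map (Subgroup.closure (u : Set G)).subtype := ⟨_, hcD, rfl⟩
  constructor
  · obtain ⟨x, hx, hxa⟩ := hs _ hcD' fun g hg => hconj g (by simp [u, hg])
    rwa [← show x = ⟨a, _⟩ from Subtype.ext hxa]
  · obtain ⟨x, hx, hxb⟩ := ht _ hcD' fun g hg => hconj g (by simp [u, hg])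
    rwa [← show x = ⟨b, _⟩ from Subtype.ext hxb]
end

section
/- Let G be a group containing subgroups H_1, H_2, ..., H_l such that each H_i is nonabelian and [H_i, H_j] = 1 for all i ≠ j (i.e. the subgroups pairwise commute elementwise). Then the chain of centralizers G > C_G(H_1) > C_G(H_1 H_2) > ... > C_G(H_1 H_2 ... H_l) has all inclusions strict; in particular, the c-dimension of G is at least l. -/
/-- Let `G` be a group containing subgroups `H_1, ..., H_l` such that each `H_i` is
nonabelian and `[H_i, H_j] = 1` for `i ≠ j`. Then the chain of centralizers
`G > C_G(H_1) > C_G(H_1 H_2) > ... > C_G(H_1 H_2 ⋯ H_l)` has all inclusions strict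
(here `C_G(H_1 ⋯ H_m)` is the centralizer of the union of `H_1, ..., H_m`);
in particular, the `c`-dimension of `G` is at least `l`, i.e. there is a strict chain
of centralizers `C_G(X_0) < C_G(X_1) < ... < C_G(X_l)`. -/
theorem strictAnti_centralizer_chain_of_pairwise_commuting (G : Type*) [Group G]
    (l : ℕ) (H : Fin l → Subgroup G)
    (hnonab : ∀ i, ∃ a ∈ H i, ∃ b ∈ H i, a * b ≠ b * a)
    (hcomm : ∀ i j, i ≠ j → ∀ x ∈ H i, ∀ y ∈ H j, x * y = y * x) :
    (StrictAnti fun m : Fin (l + 1) =>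
      Subgroup.centralizer (⋃ j ∈ {j : Fin l | (j : ℕ) < (m : ℕ)}, (H j : Set G))) ∧
    ∃ X : Fin (l + 1) → Set G, StrictMono fun i => Subgroup.centralizer (X i) := by
  have hanti : StrictAnti fun m : Fin (l + 1) =>
      Subgroup.centralizer (⋃ j ∈ {j : Fin l | (j : ℕ) < (m : ℕ)}, (H j : Set G)) := by
    intro m n hmn
    have hlt : (m : ℕ) < n := hmn
    let i : Fin l := ⟨m, by omega⟩
    refine SetLike.lt_iff_le_and_exists.2 ⟨Subgroup.centralizer_le ?_, ?_⟩
    · exact Set.biUnion_subset_biUnion_left fun j (hj : (j : ℕ) < m) => hj.trans hlt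
    · obtain ⟨a, ha, b, hb, hab⟩ := hnonab i
      refine ⟨a, Subgroup.mem_centralizer_iff.2 fun x hx => ?_, fun h => ?_⟩
      · obtain ⟨j, hj, hxj⟩ := Set.mem_iUnion₂.1 hx
        exact hcomm j i (Fin.ne_of_lt hj) x hxj a ha
      · exact hab (Subgroup.mem_centralizer_iff.1 h b (Set.mem_iUnion₂.2 ⟨i, hlt, hb⟩)).symm
  exact ⟨hanti, _, hanti.comp Fin.rev_strictAnti⟩
end

section
/- Let G be a finite group of c-dimension k whose soluble radical R (the largest normal soluble subgroup of G) is nilpotent, and suppose that the quotient G/R is a direct product of n nonabelian simple groups S_1 × S_2 × ... × S_n. Then n ≤ 4k. -/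
/-- The property that a group `G` has `c`-dimension exactly `k`: there is a strict chain of
centralizers `C_G(X_0) < C_G(X_1) < ... < C_G(X_k)` of subsets `X_i` of `G`
(a chain of length `k`), and there is no such chain of length `k + 1`. -/
def HasCDimension (G : Type*) [Group G] (k : ℕ) : Prop :=
  (∃ X : Fin (k + 1) → Set G, StrictMono fun i => Subgroup.centralizer (X i)) ∧
    ¬∃ X : Fin (k + 2) → Set G, StrictMono fun i => Subgroup.centralizer (X i)

theorem exists_centralizer_rank {G : Type*} [Group G] {k : ℕ}
    (hk : ¬∃ X : Fin (k + 2) → Set G, StrictMono fun i => Subgroup.centralizer (X i)) :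
    ∃ h : Set G → ℕ, (∀ X, h X ≤ k) ∧
      ∀ X Y, Subgroup.centralizer X < Subgroup.centralizer Y → h X < h Y := by
  classical
  let P : Set G → ℕ → Prop := fun X m => ∃ f : Fin (m + 1) → Set G,
    (StrictMono fun i => Subgroup.centralizer (f i)) ∧ f (Fin.last m) = X
  have hP0 : ∀ X, P X 0 := fun X => ⟨fun _ => X, fun a b hab => by omega, rfl⟩
  have hle : ∀ X, Nat.findGreatest (P X) k ≤ k := fun X => Nat.findGreatest_le k
  refine ⟨fun X => Nat.findGreatest (P X) k, hle, fun X Y hXY => ?_⟩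
  have hX : P X (Nat.findGreatest (P X) k) :=
    Nat.findGreatest_spec (P := P X) (Nat.zero_le k) (hP0 X)
  have hmk' := hle X
  change Nat.findGreatest (P X) k < Nat.findGreatest (P Y) k
  generalize Nat.findGreatest (P X) k = m at hX hmk' ⊢
  obtain ⟨f, hf, hfX⟩ := hX
  have hY : P Y (m + 1) := by
    refine ⟨Fin.snoc f Y, ?_, by simp⟩
    rw [Fin.strictMono_iff_lt_succ]
    intro i
    induction i using Fin.lastCases with
    | last => simpa [hfX] using hXY
    | cast i =>
      simp only [Fin.succ_castSucc, Fin.snoc_castSucc]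
      exact hf Fin.castSucc_lt_succ
  have hmk : m + 1 ≤ k := by
    rcases Nat.lt_or_ge m k with h | h
    · exact h
    · have hmk : m = k := le_antisymm hmk' h
      rw [hmk] at hY
      exact absurd ⟨_, hY.choose_spec.1⟩ hk
  exact Nat.le_findGreatest hmk hY

theorem exists_quarter_cut {ι α : Type*} [Fintype ι] [DecidableEq α] (p q : ι → α)
    (hpq : ∀ i, p i ≠ q i) :
    ∃ P : Finset α, Fintype.card ι ≤ 4 * (Finset.univ.filter fun i => p i ∈ P ∧ q i ∉ P).card := by
  classical
  let U : Finset α := Finset.univ.image p ∪ Finset.univ.image q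
  have hcount : ∀ i, 4 * (U.powerset.filter fun P => p i ∈ P ∧ q i ∉ P).card = 2 ^ U.card := by
    intro i
    have hp : p i ∈ U := by simp [U]
    have hq : q i ∈ U := by simp [U]
    have himg : (U.powerset.filter fun P => p i ∈ P ∧ q i ∉ P) =
        ((U.erase (p i)).erase (q i)).powerset.image (insert (p i)) := by
      ext P
      simp only [Finset.mem_filter, Finset.mem_powerset, Finset.mem_image]
      constructor
      · rintro ⟨h1, h2, h3⟩
        refine ⟨P.erase (p i), ?_, Finset.insert_erase h2⟩
        intro x hx
        simp only [Finset.mem_erase] at hx ⊢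
        exact ⟨fun h => h3 (h ▸ hx.2), hx.1, h1 hx.2⟩
      · rintro ⟨Q, hQ, rfl⟩
        refine ⟨?_, Finset.mem_insert_self _ _, ?_⟩
        · intro x hx
          rcases Finset.mem_insert.1 hx with rfl | hx
          · exact hp
          · exact Finset.mem_of_mem_erase (Finset.mem_of_mem_erase (hQ hx))
        · intro hx
          rcases Finset.mem_insert.1 hx with h | hx
          · exact hpq i h.symm
          · simpa using hQ hx
    rw [himg, Finset.card_image_of_injOn, Finset.card_powerset, Finset.card_erase_of_mem,
      Finset.card_erase_of_mem hp]
    · have h2 : 2 ≤ U.card := by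
        rw [← Finset.card_pair (hpq i)]
        exact Finset.card_le_card (by simp [Finset.insert_subset_iff, hp, hq])
      obtain ⟨c, hc⟩ := Nat.exists_eq_add_of_le h2
      rw [hc, show 2 + c - 1 - 1 = c by omega, pow_add]
      norm_num
    · exact Finset.mem_erase.2 ⟨(hpq i).symm, hq⟩
    · intro A hA B hB hAB
      have hA' : p i ∉ A := fun h => by simpa using (Finset.mem_powerset.1 hA) h
      have hB' : p i ∉ B := fun h => by simpa using (Finset.mem_powerset.1 hB) h
      rw [← Finset.erase_insert hA', ← Finset.erase_insert hB', hAB]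
  by_contra! hlt
  have hswap : ∑ P ∈ U.powerset, (Finset.univ.filter fun i => p i ∈ P ∧ q i ∉ P).card =
      ∑ i, (U.powerset.filter fun P => p i ∈ P ∧ q i ∉ P).card := by
    simp only [Finset.card_filter]
    exact Finset.sum_comm
  have h1 : 4 * ∑ P ∈ U.powerset, (Finset.univ.filter fun i => p i ∈ P ∧ q i ∉ P).card <
      ∑ _P ∈ U.powerset, Fintype.card ι := by
    rw [Finset.mul_sum]
    exact Finset.sum_lt_sum_of_nonempty ⟨∅, by simp⟩ fun P _ => hlt P
  rw [hswap, Finset.mul_sum, Finset.sum_congr rfl fun i _ => hcount i] at h1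
  simp [mul_comm] at h1

theorem exists_common_fixed_in_coset {G ι : Type*} [Group G] [Finite G] (M : Subgroup G) [M.Normal]
    (L : Subgroup G) (hML : M ≤ L) (d : ι → G) (q e : ι → ℕ) (s : Finset ι)
    (hq : ∀ i ∈ s, (q i).Prime ∧ ¬ q i ∣ Nat.card M)
    (hcomm : ∀ i ∈ s, ∀ j ∈ s, ∀ y ∈ L,
      d i * d j * y * (d i * d j)⁻¹ = d j * d i * y * (d j * d i)⁻¹)
    (hpow : ∀ i ∈ s, ∀ y ∈ L, Commute (d i ^ q i ^ e i) y)
    (x : G) (hxL : x ∈ L) (hx : ∀ i ∈ s, d i * x * (d i)⁻¹ * x⁻¹ ∈ M) :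
    ∃ m ∈ M, ∀ i ∈ s, Commute (d i) (m * x) := by
  classical
  induction s using Finset.induction_on with
  | empty => exact ⟨1, one_mem _, by simp⟩
  | insert i s his ih =>
    obtain ⟨m₀, hm₀, hfix₀⟩ := ih (fun i hi => hq i (Finset.mem_insert_of_mem hi))
      (fun i hi j hj => hcomm i (Finset.mem_insert_of_mem hi) j (Finset.mem_insert_of_mem hj))
      (fun i hi => hpow i (Finset.mem_insert_of_mem hi))
      (fun i hi => hx i (Finset.mem_insert_of_mem hi))
    have hi : i ∈ insert i s := Finset.mem_insert_self i s
    let F : Set G := {y | y * x⁻¹ ∈ M ∧ ∀ j ∈ s, Commute (d j) y}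
    have hFL : ∀ y ∈ F, y ∈ L := fun y hy => by
      simpa using L.mul_mem (hML hy.1) hxL
    let C : Subgroup G := M ⊓ Subgroup.centralizer (d '' s)
    have hmemC : ∀ c, c ∈ C ↔ c ∈ M ∧ ∀ j ∈ s, Commute (d j) c := by
      intro c
      simp [C, Subgroup.mem_inf, Subgroup.mem_centralizer_iff, Commute, SemiconjBy]
    have hcard : Nat.card F = Nat.card C := by
      refine Nat.card_congr ⟨fun y => ⟨y.1 * (m₀ * x)⁻¹, ?_⟩, fun c => ⟨c.1 * (m₀ * x), ?_⟩,
        fun y => Subtype.ext (inv_mul_cancel_right _ _),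
        fun c => Subtype.ext (mul_inv_cancel_right _ _)⟩
      · refine (hmemC _).2 ⟨?_, fun j hj => (y.2.2 j hj).mul_right (hfix₀ j hj).inv_right⟩
        have := M.mul_mem y.2.1 (M.inv_mem hm₀)
        simpa [mul_assoc] using this
      · have hc := (hmemC _).1 c.2
        refine ⟨?_, fun j hj => (hc.2 j hj).mul_right (hfix₀ j hj)⟩
        simpa [mul_assoc] using M.mul_mem hc.1 hm₀
    have hmaps : ∀ y ∈ F, d i * y * (d i)⁻¹ ∈ F := by
      intro y hy
      refine ⟨?_, fun j hj => ?_⟩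
      · have h1 := ‹M.Normal›.conj_mem _ hy.1 (d i)
        have h2 := M.mul_mem h1 (hx i hi)
        simpa [mul_assoc] using h2
      · have h1 := hcomm i hi j (Finset.mem_insert_of_mem hj) y (hFL y hy)
        have h2 : d j * y * (d j)⁻¹ = y := by rw [(hy.2 j hj).eq]; group
        rw [commute_iff_eq, ← mul_inv_eq_iff_eq_mul]
        calc d j * (d i * y * (d i)⁻¹) * (d j)⁻¹ = d j * d i * y * (d j * d i)⁻¹ := by group
          _ = d i * d j * y * (d i * d j)⁻¹ := h1.symm
          _ = d i * (d j * y * (d j)⁻¹) * (d i)⁻¹ := by group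
          _ = _ := by rw [h2]
    let f : Function.End F := fun y => ⟨d i * y.1 * (d i)⁻¹, hmaps _ y.2⟩
    have hfn : ∀ (n : ℕ) (y : F), ((f ^ n : Function.End F) y : G) = d i ^ n * y * (d i ^ n)⁻¹ := by
      intro n
      induction n with
      | zero => intro y; rw [pow_zero, pow_zero, inv_one, mul_one, one_mul]; rfl
      | succ n ihn =>
        intro y
        have : (f ^ (n + 1) : Function.End F) y = (f ^ n : Function.End F) (f y) := by
          rw [pow_succ]; rfl
        rw [this, ihn]
        simp only [f, pow_succ]
        group
    have hf1 : f ^ q i ^ e i = 1 := by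
      funext y
      apply Subtype.ext
      rw [hfn, (hpow i hi _ (hFL _ y.2)).eq]
      exact mul_inv_cancel_right _ _
    have := Fact.mk (hq i hi).1
    have := Fintype.ofFinite F
    have hmod := Equiv.Perm.card_fixedPoints_modEq (f := f) hf1
    have hne : Nonempty (Function.fixedPoints f) := by
      by_contra hemp
      rw [not_nonempty_iff] at hemp
      replace hmod : Fintype.card F ≡ 0 [MOD q i] :=
        hmod.trans (by rw [Fintype.card_eq_zero_iff.2 hemp])
      rw [← Nat.card_eq_fintype_card,
        Nat.modEq_zero_iff_dvd, hcard] at hmod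
      exact (hq i hi).2 (hmod.trans (Subgroup.card_dvd_of_le inf_le_left))
    obtain ⟨⟨y, hyF⟩, hy⟩ := hne
    refine ⟨y * x⁻¹, hyF.1, fun j hj => ?_⟩
    rw [inv_mul_cancel_right]
    rcases Finset.mem_insert.1 hj with rfl | hj
    · have := congrArg Subtype.val (hy : f ⟨y, hyF⟩ = ⟨y, hyF⟩)
      rw [commute_iff_eq, ← mul_inv_eq_iff_eq_mul]
      exact this
    · exact hyF.2 j hj

theorem mul_pow_of_central_commutator {G : Type*} [Group G] {x y c : G}
    (hc : c ∈ Subgroup.center G) (h : y * x = x * y * c) (n : ℕ) :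
    (x * y) ^ n = x ^ n * y ^ n * c ^ n.choose 2 := by
  have hcc : ∀ g, Commute c g := fun g => (Subgroup.mem_center_iff.1 hc g).symm
  have hyx : ∀ n : ℕ, y ^ n * x = x * y ^ n * c ^ n := by
    intro n
    induction n with
    | zero => simp
    | succ n ih =>
      calc y ^ (n + 1) * x = y ^ n * (y * x) := by rw [pow_succ, mul_assoc]
        _ = (y ^ n * x) * y * c := by rw [h]; simp only [mul_assoc]
        _ = x * y ^ n * (c ^ n * y) * c := by rw [ih]; simp only [mul_assoc]
        _ = x * y ^ (n + 1) * c ^ (n + 1) := by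
          rw [((hcc y).pow_left n).eq]; simp only [pow_succ, mul_assoc]
  induction n with
  | zero => simp
  | succ n ih =>
    calc (x * y) ^ (n + 1) = x ^ n * y ^ n * (c ^ n.choose 2 * (x * y)) := by
          rw [pow_succ, ih]; simp only [mul_assoc]
      _ = x ^ n * (y ^ n * x) * y * c ^ n.choose 2 := by
          rw [((hcc (x * y)).pow_left _).eq]; simp only [mul_assoc]
      _ = x ^ n * x * y ^ n * (c ^ n * y) * c ^ n.choose 2 := by
          rw [hyx]; simp only [mul_assoc]
      _ = x ^ (n + 1) * y ^ (n + 1) * c ^ (n + 1).choose 2 := by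
          rw [((hcc y).pow_left n).eq, Nat.choose_succ_succ' n 1, Nat.choose_one_right, pow_add c,
            pow_succ x n, pow_succ y n]
          simp only [mul_assoc]

theorem IsPGroup.exists_index_eq_prime_of_mem {p : ℕ} [Fact p.Prime] {Q : Type*} [Group Q]
    [Finite Q] (hQ : IsPGroup p Q) (hc : ¬ IsCyclic Q) (x : Q) :
    ∃ M : Subgroup Q, M.Normal ∧ M.index = p ∧ x ∈ M := by
  obtain ⟨n, hn⟩ := IsPGroup.iff_card.1 hQ
  obtain ⟨j, hj⟩ := IsPGroup.iff_card.1 (hQ.to_subgroup (Subgroup.zpowers x))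
  have hp := (Fact.out : p.Prime)
  have hjn : j < n := by
    by_contra! h
    refine hc (isCyclic_iff_exists_zpowers_eq_top.2 ⟨x, ?_⟩)
    apply Subgroup.eq_top_of_le_card
    rw [hn, hj]
    exact Nat.pow_le_pow_right hp.pos h
  obtain ⟨M, hM, hle⟩ := Sylow.exists_subgroup_card_pow_prime_le (G := Q) p (m := n - 1)
    (by rw [hn]; exact pow_dvd_pow p (by omega)) (Subgroup.zpowers x) hj (by omega)
  have hidx : M.index = p := by
    have h := M.card_mul_index
    rw [hM, hn, show n = (n - 1) + 1 by omega, pow_succ, Nat.add_sub_cancel] at h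
    exact Nat.eq_of_mul_eq_mul_left (pow_pos hp.pos _) h
  refine ⟨M, ?_, hidx, hle (Subgroup.mem_zpowers x)⟩
  apply Subgroup.normal_of_index_eq_minFac_card
  rw [hidx, hn, hp.pow_minFac (by omega)]

theorem IsPGroup.exists_commute_of_not_isCyclic {p : ℕ} [Fact p.Prime] (hp2 : p ≠ 2) {Q : Type*}
    [Group Q] [Finite Q] (hQ : IsPGroup p Q) (hc : ¬ IsCyclic Q) :
    ∃ a b : Q, Commute a b ∧ a ^ p = 1 ∧ b ^ p = 1 ∧ b ≠ 1 ∧ a ∉ Subgroup.zpowers b := by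
  have hp := (Fact.out : p.Prime)
  induction hn : Nat.card Q using Nat.strong_induction_on generalizing Q with
  | _ n ih =>
  by_cases hcyc : ∀ H : Subgroup Q, H ≠ ⊤ → IsCyclic H
  swap
  · push Not at hcyc
    obtain ⟨H, hH, hHc⟩ := hcyc
    have hlt : Nat.card H < n := by
      rw [← hn]
      exact lt_of_le_of_ne (Subgroup.card_le_card_group H) fun h =>
        hH (Subgroup.eq_top_of_card_eq H h)
    obtain ⟨a, b, hab, ha, hb, hb1, hmem⟩ := ih _ hlt (hQ.to_subgroup H) (by simpa using hHc) rfl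
    refine ⟨a, b, congrArg Subtype.val hab.eq, congrArg Subtype.val ha, congrArg Subtype.val hb,
      fun h => hb1 (Subtype.ext h), ?_⟩
    rintro ⟨z, hz⟩
    exact hmem ⟨z, Subtype.ext (by simpa using hz)⟩
  obtain ⟨M, hMn, hMi, -⟩ := hQ.exists_index_eq_prime_of_mem hc 1
  have htop : ∀ N : Subgroup Q, N.index = p → N ≠ ⊤ := by
    rintro N hN rfl
    rw [Subgroup.index_top] at hN
    exact hp.one_lt.ne hN
  obtain ⟨x, hxM⟩ : ∃ x, x ∉ M := by
    by_contra! h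
    exact htop M hMi (eq_top_iff.2 fun x _ => h x)
  obtain ⟨N, hNn, hNi, hxN⟩ := hQ.exists_index_eq_prime_of_mem hc x
  have hlt : M < M ⊔ N := lt_of_le_of_ne le_sup_left fun h => hxM (h ▸ (le_sup_right : N ≤ _) hxN)
  have hsup : M ⊔ N = ⊤ := by
    have hdvd := Subgroup.index_dvd_of_le hlt.le
    rw [hMi, Nat.dvd_prime hp] at hdvd
    rcases hdvd with h | h
    · exact Subgroup.index_eq_one.1 h
    · have h1 := Subgroup.relIndex_mul_index hlt.le
      rw [h, hMi] at h1
      have h2 : M.relIndex (M ⊔ N) = 1 := Nat.eq_of_mul_eq_mul_right hp.pos (by rw [h1, one_mul])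
      exact absurd (Subgroup.relIndex_eq_one.1 h2) (not_le_of_gt hlt)
  have hcomm : ∀ K : Subgroup Q, K.index = p → ∀ u ∈ K, ∀ v ∈ K, u * v = v * u := by
    intro K hK u hu v hv
    have := hcyc K (htop K hK)
    have h := (IsCyclic.isMulCommutative (α := K)).is_comm.comm ⟨u, hu⟩ ⟨v, hv⟩
    exact congrArg Subtype.val h
  have hcen : M ⊓ N ≤ Subgroup.center Q := by
    intro z hz
    rw [Subgroup.mem_center_iff]
    have hle : M ⊔ N ≤ Subgroup.centralizer {z} := by
      refine sup_le ?_ ?_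
      · intro u hu
        rw [Subgroup.mem_centralizer_singleton_iff]
        exact hcomm M hMi _ hu _ hz.1
      · intro u hu
        rw [Subgroup.mem_centralizer_singleton_iff]
        exact hcomm N hNi _ hu _ hz.2
    intro g
    have := hle (hsup ▸ Subgroup.mem_top g)
    exact Subgroup.mem_centralizer_singleton_iff.1 this
  have hquot : ∀ K : Subgroup Q, K.Normal → K.index = p →
      (∀ u, u ^ p ∈ K) ∧ ∀ u v, (u * v)⁻¹ * (v * u) ∈ K := by
    intro K hKn hK
    have hcard : Nat.card (Q ⧸ K) = p := hK
    refine ⟨fun u => ?_, fun u v => ?_⟩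
    · rw [← hK]
      exact Subgroup.pow_index_mem K u
    · have : IsCyclic (Q ⧸ K) := isCyclic_of_prime_card hcard
      rw [← QuotientGroup.eq]
      exact (IsCyclic.isMulCommutative (α := Q ⧸ K)).is_comm.comm u v
  have hpow : ∀ u, u ^ p ∈ M ⊓ N := fun u => ⟨(hquot M hMn hMi).1 u, (hquot N hNn hNi).1 u⟩
  have hmul : ∀ u v : Q, (u * v) ^ p = u ^ p * v ^ p := by
    intro u v
    have hcc := hcen ⟨(hquot M hMn hMi).2 u v, (hquot N hNn hNi).2 u v⟩
    have heq : v * u = u * v * ((u * v)⁻¹ * (v * u)) := by group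
    generalize (u * v)⁻¹ * (v * u) = c at hcc heq
    have hcg : ∀ g, Commute c g := fun g => (Subgroup.mem_center_iff.1 hcc g).symm
    have hconj : v * u * v⁻¹ = u * c := by
      rw [heq, mul_assoc u v c, ← (hcg v).eq]; group
    have hcp : c ^ p = 1 := by
      have h1 : (v * u * v⁻¹) ^ p = u ^ p := by
        rw [conj_pow, Subgroup.mem_center_iff.1 (hcen (hpow u)) v]; group
      rw [hconj, (hcg u).symm.mul_pow] at h1
      exact mul_eq_left.1 h1
    rw [mul_pow_of_central_commutator hcc heq]
    obtain ⟨t, ht⟩ : p ∣ p.choose 2 :=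
      hp.dvd_choose_self two_ne_zero (lt_of_le_of_ne hp.two_le (Ne.symm hp2))
    rw [ht, pow_mul, hcp, one_pow, mul_one]
  let f : Q →* Q := MonoidHom.mk' (fun u => u ^ p) hmul
  have hker : p < Nat.card f.ker := by
    have h1 : Nat.card f.range ∣ Nat.card (M ⊓ N : Subgroup Q) :=
      Subgroup.card_dvd_of_le (by rintro _ ⟨u, rfl⟩; exact hpow u)
    have h2 : p < (M ⊓ N).index := by
      have hlt : M ⊓ N < M := lt_of_le_of_ne inf_le_left fun h => by
        have hMN : M ≤ N := h ▸ inf_le_right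
        exact htop N hNi (by rw [← hsup]; exact (sup_eq_right.2 hMN).symm)
      have h3 := Subgroup.relIndex_mul_index hlt.le
      rw [hMi] at h3
      have h4 : (M ⊓ N).relIndex M ≠ 1 := fun h =>
        absurd (Subgroup.relIndex_eq_one.1 h) (not_le_of_gt hlt)
      have h5 : (M ⊓ N).relIndex M ≠ 0 := fun h => by
        rw [h, zero_mul] at h3
        exact Subgroup.index_ne_zero_of_finite h3.symm
      nlinarith [hp.pos, show 2 ≤ (M ⊓ N).relIndex M by omega]
    have h3 := f.ker.card_mul_index
    rw [Subgroup.index_ker, ← (M ⊓ N).card_mul_index] at h3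
    have h4 := Nat.le_of_dvd Nat.card_pos h1
    have h5 : 0 < Nat.card f.range := Nat.card_pos
    by_contra! h6
    have h7 : Nat.card f.ker * Nat.card f.range ≤ p * Nat.card (M ⊓ N : Subgroup Q) :=
      Nat.mul_le_mul h6 h4
    nlinarith [h5.trans_le h4]
  have : Nontrivial Q := ⟨x, 1, fun h => hxM (h ▸ one_mem M)⟩
  have := hQ.center_nontrivial
  obtain ⟨z, hz⟩ : ∃ z : Subgroup.center Q, orderOf z = p := by
    obtain ⟨t, ht⟩ := IsPGroup.iff_card.1 (hQ.to_subgroup (Subgroup.center Q))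
    apply exists_prime_orderOf_dvd_card'
    rw [ht]
    exact dvd_pow_self p fun h => by
      rw [h, pow_zero] at ht
      exact Finite.one_lt_card.ne' ht
  have hz' : orderOf (z : Q) = p := by rw [Subgroup.orderOf_coe, hz]
  obtain ⟨a, ha, haz⟩ : ∃ a ∈ f.ker, a ∉ Subgroup.zpowers (z : Q) := by
    by_contra! h
    have := Subgroup.card_le_of_le (show f.ker ≤ Subgroup.zpowers (z : Q) from h)
    rw [Nat.card_zpowers, hz'] at this
    omega
  refine ⟨a, z, Subgroup.mem_center_iff.1 z.2 a, ha, ?_, fun h => ?_, haz⟩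
  · rw [← hz']; exact pow_orderOf_eq_one _
  · rw [h, orderOf_one] at hz'
    exact hp.one_lt.ne hz'

universe u v

open scoped commutatorElement

/-- The subgroup `A` of `S` has a nontrivial element with a nontrivial fixed point in every
nontrivial invariant subgroup of a finite abelian group of order prime to `q` on which `S` has no
nontrivial fixed points. -/
def FixesCoprime.{w, x} {S : Type w} [Group S] (q : ℕ) (A : Subgroup S) : Prop :=
  ∀ (E : Type x) [CommGroup E] [Finite E] (ρ : S →* MulAut E) (L : Subgroup E),
    ¬ q ∣ Nat.card E → L ≠ ⊥ → (∀ s, ∀ m ∈ L, ρ s m ∈ L) →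
    (∀ m ∈ L, (∀ s, ρ s m = m) → m = 1) → ∃ y ∈ A, y ≠ 1 ∧ ∃ m ∈ L, m ≠ 1 ∧ ρ y m = m

theorem IsSimpleGroup.center_eq_bot {S : Type*} [Group S] [IsSimpleGroup S]
    (hS : ∃ a b : S, a * b ≠ b * a) : Subgroup.center S = ⊥ := by
  refine (inferInstance : (Subgroup.center S).Normal).eq_bot_or_eq_top.resolve_right fun h => ?_
  obtain ⟨a, b, hab⟩ := hS
  exact hab (Subgroup.mem_center_iff.1 (h ▸ Subgroup.mem_top b) a)

theorem IsSimpleGroup.fixes_of_fixes {S E : Type*} [Group S] [IsSimpleGroup S] [Group E]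
    (ρ : S →* MulAut E) {L : Subgroup E} (hinv : ∀ s, ∀ m ∈ L, ρ s m ∈ L) {y : S} (hy : y ≠ 1)
    (hfix : ∀ m ∈ L, ρ y m = m) (s : S) : ∀ m ∈ L, ρ s m = m := by
  let K : Subgroup S :=
    { carrier := {s | ∀ m ∈ L, ρ s m = m}
      one_mem' := fun m _ => by simp
      mul_mem' := fun {s t} hs ht m hm => by rw [map_mul, MulAut.mul_apply, ht m hm, hs m hm]
      inv_mem' := fun {s} hs m hm => by
        rw [map_inv]
        exact (MulEquiv.symm_apply_eq _).2 (hs m hm).symm }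
  have hK : K.Normal := ⟨fun s hs t m hm => by
    have h1 := hs _ (hinv t⁻¹ m hm)
    rw [map_mul, map_mul, MulAut.mul_apply, MulAut.mul_apply, h1, ← MulAut.mul_apply, ← map_mul,
      mul_inv_cancel, map_one, MulAut.one_apply]⟩
  rcases hK.eq_bot_or_eq_top with h | h
  · exact absurd (Subgroup.mem_bot.1 (h ▸ (show y ∈ K from hfix))) hy
  · exact (h ▸ Subgroup.mem_top s : s ∈ K)

theorem IsSimpleGroup.fixesCoprime_zpowers {S : Type u} [Group S] [IsSimpleGroup S]
    (hS : ∃ a b : S, a * b ≠ b * a) {y : S} (hy : y ≠ 1) (hy2 : y ^ 2 = 1) (q : ℕ) :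
    FixesCoprime.{u, v} q (Subgroup.zpowers y) := by
  intro E _ _ ρ L _ hL hinv hfix
  refine ⟨y, Subgroup.mem_zpowers y, hy, ?_⟩
  by_contra! hno
  have hneg : ∀ m ∈ L, ρ y m = m⁻¹ := by
    intro m hm
    by_contra hne
    refine hno (m * ρ y m) (L.mul_mem hm (hinv y m hm)) (fun h => hne ?_) ?_
    · exact (inv_eq_of_mul_eq_one_right h).symm
    · have : ρ y (ρ y m) = m := by
        rw [← MulAut.mul_apply, ← map_mul, ← sq, hy2, map_one, MulAut.one_apply]
      rw [map_mul, this, mul_comm]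
  have hcen : y ∈ Subgroup.center S := by
    rw [Subgroup.mem_center_iff]
    intro s
    have h : s * y * (s⁻¹ * y) = 1 := by
      by_contra hne
      refine hL ((Subgroup.eq_bot_iff_forall _).2 fun m hm => hfix m hm fun t => ?_)
      refine fixes_of_fixes ρ hinv hne (fun m hm => ?_) t m hm
      simp only [map_mul, MulAut.mul_apply]
      rw [hneg m hm, hneg _ (hinv _ _ (L.inv_mem hm)), map_inv, map_inv, map_inv, inv_inv,
        ← MulAut.mul_apply, ← map_mul, mul_inv_cancel, map_one, MulAut.one_apply]
    rw [eq_inv_of_mul_eq_one_left h, mul_inv_rev, inv_inv,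
      inv_eq_of_mul_eq_one_right (by rw [← sq, hy2] : y * y = 1)]
  exact hy (Subgroup.mem_bot.1 (center_eq_bot hS ▸ hcen))

theorem fixesCoprime_of_commute {S : Type u} [Group S] {q : ℕ} (hq : q.Prime) (A : Subgroup S)
    {a b : S} (ha : a ∈ A) (hb : b ∈ A) (hab : Commute a b) (haq : a ^ q = 1) (hbq : b ^ q = 1)
    (hb1 : b ≠ 1) (hmem : a ∉ Subgroup.zpowers b) : FixesCoprime.{u, v} q A := by
  intro E _ _ ρ L hqE hL hinv _
  by_contra! hno
  obtain ⟨⟨m, hm⟩, hne⟩ := Subgroup.ne_bot_iff_exists_ne_one.1 hL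
  have hm1 : m ≠ 1 := fun h => hne (Subtype.ext h)
  have hnorm : ∀ g ∈ A, g ≠ 1 → g ^ q = 1 → ∏ j ∈ Finset.range q, ρ (g ^ j) m = 1 := by
    intro g hg hg1 hgq
    by_contra hne
    refine hno g hg hg1 _ (L.prod_mem fun j _ => hinv _ m hm) hne ?_
    rw [map_prod]
    have h1 : ∀ j, ρ g (ρ (g ^ j) m) = ρ (g ^ (j + 1)) m := fun j => by
      rw [← MulAut.mul_apply, ← map_mul, ← pow_succ']
    simp only [h1]
    have h2 := Finset.prod_range_succ (fun j => ρ (g ^ j) m) q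
    rw [Finset.prod_range_succ', hgq, pow_zero] at h2
    exact mul_right_cancel h2
  have hmq : m ^ q = 1 := by
    calc m ^ q = ∏ j ∈ Finset.range q, ∏ i ∈ Finset.range q, ρ ((a * b ^ i) ^ j) m := by
          rw [← Finset.prod_erase_mul _ _ (Finset.mem_range.2 hq.pos), Finset.prod_eq_one]
          · simp
          · intro j hj
            rw [Finset.mem_erase, Finset.mem_range] at hj
            have h1 : ∀ i, ρ ((a * b ^ i) ^ j) m = ρ (a ^ j) (ρ ((b ^ j) ^ i) m) := fun i => by
              rw [(hab.pow_right i).mul_pow, map_mul, MulAut.mul_apply, ← pow_mul, ← pow_mul,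
                mul_comm]
            simp only [h1]
            rw [← map_prod, hnorm _ (A.pow_mem hb j), map_one]
            · intro h
              have h2 := orderOf_dvd_of_pow_eq_one h
              rw [orderOf_eq_prime hbq hb1 (hp := ⟨hq⟩)] at h2
              exact absurd (Nat.le_of_dvd (Nat.pos_of_ne_zero hj.1) h2) (by omega)
            · rw [← pow_mul, mul_comm, pow_mul, hbq, one_pow]
      _ = ∏ i ∈ Finset.range q, ∏ j ∈ Finset.range q, ρ ((a * b ^ i) ^ j) m := Finset.prod_comm
      _ = 1 := by
          refine Finset.prod_eq_one fun i _ => ?_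
          refine hnorm _ (A.mul_mem ha (A.pow_mem hb i)) (fun h => hmem ?_) ?_
          · rw [eq_inv_of_mul_eq_one_left h]
            exact inv_mem (pow_mem (Subgroup.mem_zpowers b) i)
          · rw [(hab.pow_right i).mul_pow, haq, ← pow_mul, mul_comm, pow_mul, hbq, one_pow, one_mul]
  have h1 := orderOf_eq_prime hmq hm1 (hp := ⟨hq⟩)
  exact hqE (h1 ▸ orderOf_dvd_natCard m)

theorem IsSimpleGroup.exists_fixesCoprime (S : Type u) [Group S] [Finite S] [IsSimpleGroup S]
    (hS : ∃ a b : S, a * b ≠ b * a) :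
    ∃ q : ℕ, q.Prime ∧ ∃ A : Subgroup S, A ≠ ⊥ ∧ IsPGroup q A ∧ FixesCoprime.{u, v} q A := by
  by_cases h2 : 2 ∣ Nat.card S
  · obtain ⟨y, hy⟩ := exists_prime_orderOf_dvd_card' 2 h2 (hp := ⟨Nat.prime_two⟩)
    have hy1 : y ≠ 1 := fun h => by simp [h] at hy
    refine ⟨2, Nat.prime_two, Subgroup.zpowers y, by simpa using hy1, ?_, fixesCoprime_zpowers hS hy1
      (by rw [← hy]; exact pow_orderOf_eq_one y) 2⟩
    exact IsPGroup.of_card (n := 1) (by rw [Nat.card_zpowers, hy, pow_one])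
  · have hZ : ¬ IsZGroup S := fun h => by
      obtain ⟨a, b, hab⟩ := hS
      exact hab (comm_iff_isSolvable.2 inferInstance a b)
    rw [isZGroup_iff] at hZ
    push Not at hZ
    obtain ⟨q, hq, Q, hQ⟩ := hZ
    have := Fact.mk hq
    have hq2 : q ≠ 2 := by
      rintro rfl
      refine hQ ?_
      obtain ⟨n, hn⟩ := IsPGroup.iff_card.1 Q.isPGroup'
      have h0 : n = 0 := by
        by_contra h0
        exact h2 ((dvd_pow_self 2 h0).trans (hn ▸ Subgroup.card_subgroup_dvd_card _))
      rw [h0, pow_zero] at hn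
      have := (Nat.card_eq_one_iff_unique.1 hn).1
      infer_instance
    obtain ⟨a, b, hab, ha, hb, hb1, hmem⟩ := Q.isPGroup'.exists_commute_of_not_isCyclic hq2 hQ
    refine ⟨q, hq, Q, fun h => hb1 (Subtype.ext (Subgroup.mem_bot.1 (h ▸ b.2))), Q.isPGroup',
      fixesCoprime_of_commute hq Q a.2 b.2
      (congrArg Subtype.val hab.eq) (congrArg Subtype.val ha) (congrArg Subtype.val hb)
      (fun h => hb1 (Subtype.ext h)) ?_⟩
    rintro ⟨z, hz⟩
    exact hmem ⟨z, Subtype.ext (by simpa using hz)⟩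

theorem IsSimpleGroup.exists_prime_ne_dvd_card (S : Type u) [Group S] [Finite S] [IsSimpleGroup S]
    (hS : ∃ a b : S, a * b ≠ b * a) {q : ℕ} (hq : q.Prime) :
    ∃ p : ℕ, p.Prime ∧ p ≠ q ∧ p ∣ Nat.card S := by
  by_contra! h
  have hcard := Nat.eq_prime_pow_of_unique_prime_dvd (p := q) (Nat.card_pos (α := S)).ne'
    fun {d} hd hdvd => by_contra fun hne => h d hd hne hdvd
  have := Fact.mk hq
  have := (IsPGroup.of_card hcard).isNilpotent
  obtain ⟨a, b, hab⟩ := hS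
  exact hab (comm_iff_isSolvable.2 inferInstance a b)

theorem Group.IsNilpotent.mem_of_prime_dvd_orderOf_mul {N : Type*} [Group N] [Finite N]
    (hN : Group.IsNilpotent N) (P : Set ℕ) {x y : N}
    (hx : ∀ p, p.Prime → p ∣ orderOf x → p ∈ P) (hy : ∀ p, p.Prime → p ∣ orderOf y → p ∈ P)
    {p : ℕ} (hp : p.Prime) (hxy : p ∣ orderOf (x * y)) : p ∈ P := by
  obtain ⟨φ⟩ := ((Group.isNilpotent_of_finite_tfae (G := N)).out 0 4).1 hN
  have hcoord : ∀ z : N, (∀ p, p.Prime → p ∣ orderOf z → p ∈ P) →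
      ∀ (r : (Nat.card N).primeFactors) (Q : Sylow r N), (r : ℕ) ∉ P → φ.symm z r Q = 1 := by
    intro z hz r Q hr
    have hrp : (r : ℕ).Prime := Nat.prime_of_mem_primeFactors r.2
    have := Fact.mk hrp
    obtain ⟨j, hj⟩ := (IsPGroup.iff_orderOf.1 Q.isPGroup') (φ.symm z r Q)
    rw [← orderOf_eq_one_iff, hj]
    by_contra h
    have hj0 : j ≠ 0 := fun h0 => h (by rw [h0, pow_zero])
    refine hr (hz r hrp ((dvd_pow_self _ hj0).trans ?_))
    rw [← hj, ← MulEquiv.orderOf_eq φ.symm z]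
    apply orderOf_dvd_of_pow_eq_one
    rw [← Pi.pow_apply, ← Pi.pow_apply, pow_orderOf_eq_one]
    rfl
  by_contra hpP
  obtain ⟨m, hm⟩ := hxy
  have hm0 : m ≠ 0 := fun h => (orderOf_pos (x * y)).ne' (by rw [hm, h, mul_zero])
  have hu : orderOf ((x * y) ^ m) = p := by
    rw [orderOf_pow_of_dvd hm0 ⟨p, by rw [hm, mul_comm]⟩, hm, Nat.mul_div_cancel _ (by omega)]
  have h1 : φ.symm ((x * y) ^ m) = 1 := by
    funext r Q
    have hrp : (r : ℕ).Prime := Nat.prime_of_mem_primeFactors r.2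
    have := Fact.mk hrp
    by_cases hr : (r : ℕ) ∈ P
    · obtain ⟨j, hj⟩ := (IsPGroup.iff_orderOf.1 Q.isPGroup') (φ.symm ((x * y) ^ m) r Q)
      have hdvd : orderOf (φ.symm ((x * y) ^ m) r Q) ∣ p := by
        apply orderOf_dvd_of_pow_eq_one
        rw [← Pi.pow_apply, ← Pi.pow_apply, ← map_pow, ← hu, pow_orderOf_eq_one, map_one]
        rfl
      have hco : Nat.Coprime ((r : ℕ) ^ j) p :=
        ((Nat.coprime_primes hrp hp).2 fun h => hpP (h ▸ hr)).pow_left j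
      rw [hj] at hdvd
      rw [Pi.one_apply, Pi.one_apply, ← orderOf_eq_one_iff, hj]
      exact Nat.eq_one_of_dvd_coprimes hco dvd_rfl hdvd
    · rw [map_pow, map_mul, Pi.pow_apply, Pi.pow_apply, Pi.mul_apply, Pi.mul_apply,
        hcoord x hx r Q hr, hcoord y hy r Q hr, one_mul, one_pow]
      rfl
  rw [(map_eq_one_iff _ φ.symm.injective).1 h1, orderOf_one] at hu
  exact hp.one_lt.ne hu

theorem Subgroup.exists_normal_hall {G : Type*} [Group G] [Finite G] (R : Subgroup G) [R.Normal]
    (hR : Group.IsNilpotent R) (P : Set ℕ) :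
    ∃ V : Subgroup G, V.Normal ∧ V ≤ R ∧ (∀ p, p.Prime → p ∣ Nat.card V → p ∈ P) ∧
      ∀ x ∈ R, (∀ p, p.Prime → p ∣ orderOf x → p ∈ P) → x ∈ V := by
  refine ⟨{ carrier := {x | x ∈ R ∧ ∀ p, p.Prime → p ∣ orderOf x → p ∈ P}
            one_mem' := ⟨one_mem R, fun p hp h => by
              rw [orderOf_one] at h
              exact absurd (Nat.dvd_one.1 h) hp.one_lt.ne'⟩
            mul_mem' := ?_
            inv_mem' := fun {x} hx => ⟨inv_mem hx.1, by rw [orderOf_inv]; exact hx.2⟩ },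
    ⟨fun x hx g => ⟨‹R.Normal›.conj_mem x hx.1 g, ?_⟩⟩, fun x hx => hx.1, ?_,
    fun x hx h => ⟨hx, h⟩⟩
  · intro x y hx hy
    refine ⟨R.mul_mem hx.1 hy.1, fun p hp h => ?_⟩
    refine hR.mem_of_prime_dvd_orderOf_mul P (x := ⟨x, hx.1⟩) (y := ⟨y, hy.1⟩) ?_ ?_ hp ?_
    · simpa only [Subgroup.orderOf_mk] using hx.2
    · simpa only [Subgroup.orderOf_mk] using hy.2
    · simpa only [MulMemClass.mk_mul_mk, Subgroup.orderOf_mk] using h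
  · have h : orderOf (g * x * g⁻¹) = orderOf x := by
      rw [← MulAut.conj_apply]
      exact MulEquiv.orderOf_eq _ x
    rw [h]
    exact hx.2
  · intro p hp h
    obtain ⟨x, hx⟩ := exists_prime_orderOf_dvd_card' p h (hp := ⟨hp⟩)
    refine x.2.2 p hp ?_
    rw [Subgroup.orderOf_coe, hx]

theorem Subgroup.sup_eq_of_forall_pgroup_mem {G : Type*} [Group G] [Finite G] {R U : Subgroup G}
    (hUR : U ≤ R)
    (h : ∀ p : ℕ, p.Prime → ∀ x ∈ R, (∀ r : ℕ, r.Prime → r ∣ orderOf x → r = p) → x ∈ U) :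
    U = R := by
  refine le_antisymm hUR (Subgroup.relIndex_eq_one.1 ?_)
  by_contra hne
  obtain ⟨p, hp, hdvd⟩ := Nat.exists_prime_and_dvd hne
  have := Fact.mk hp
  let Q : Sylow p R := default
  have hQ : (Q : Subgroup R) ≤ U.subgroupOf R := by
    intro x hx
    refine h p hp x x.2 fun r hr hrx => ?_
    obtain ⟨j, hj⟩ := (IsPGroup.iff_orderOf.1 Q.isPGroup') ⟨x, hx⟩
    rw [Subgroup.orderOf_mk, ← Subgroup.orderOf_coe] at hj
    rw [hj] at hrx
    exact (Nat.prime_dvd_prime_iff_eq hr hp).1 (hr.dvd_of_dvd_pow hrx)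
  exact Q.not_dvd_index (hdvd.trans (Subgroup.index_dvd_of_le hQ))

theorem MonoidHom.exists_complement_over {G Γ : Type*} [Group G] [Finite G] [Group Γ] (π : G →* Γ)
    (U U' H : Subgroup G) [U.Normal] (hker : U ⊔ U' = π.ker) (hUH : U ≤ H) (E : Subgroup Γ)
    (hE : E ≤ H.map π) (hco : (Nat.card U).Coprime (Nat.card U'))
    (hcoE : (Nat.card U).Coprime (Nat.card E)) :
    ∃ T ≤ H, T.map π = E ∧ ∀ p, p.Prime → p ∣ Nat.card T → p ∣ Nat.card U' ∨ p ∣ Nat.card E := by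
  let K : Subgroup G := H ⊓ E.comap π
  have hUR : U ≤ π.ker := hker ▸ le_sup_left
  have hUK : U ≤ K := le_inf hUH fun x hx => by
    rw [Subgroup.mem_comap, MonoidHom.mem_ker.1 (hUR hx)]
    exact one_mem E
  have hKE : K.map π = E := by
    refine le_antisymm ?_ fun y hy => ?_
    · rintro _ ⟨x, hx, rfl⟩
      exact hx.2
    · obtain ⟨x, hx, rfl⟩ := hE hy
      exact ⟨x, ⟨hx, hy⟩, rfl⟩
  have hidx : (U.subgroupOf K).index ∣ Nat.card U' * Nat.card E := by
    change U.relIndex K ∣ _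
    rw [← Subgroup.relIndex_mul_relIndex U (π.ker ⊓ K) K (le_inf hUR hUK) inf_le_right,
      Subgroup.inf_relIndex_right, Subgroup.relIndex_ker, hKE]
    refine Nat.mul_dvd_mul_right ?_ _
    have h1 := Subgroup.relIndex_mul_relIndex U (π.ker ⊓ K) π.ker (le_inf hUR hUK) inf_le_left
    refine (Dvd.intro _ h1).trans ?_
    rw [← hker, sup_comm, Subgroup.relIndex_sup_right]
    exact Subgroup.relIndex_dvd_card U U'
  have hcard : Nat.card (U.subgroupOf K) = Nat.card U :=
    Nat.card_congr (Subgroup.subgroupOfEquivOfLe hUK).toEquiv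
  obtain ⟨T, hT⟩ := Subgroup.exists_right_complement'_of_coprime (N := U.subgroupOf K)
    (by rw [hcard]; exact (hco.mul_right hcoE).coprime_dvd_right hidx)
  refine ⟨T.map K.subtype, ?_, ?_, fun p hp h => ?_⟩
  · rintro _ ⟨x, -, rfl⟩
    exact x.2.1
  · refine le_antisymm ?_ fun y hy => ?_
    · rintro _ ⟨_, ⟨x, -, rfl⟩, rfl⟩
      exact x.2.2
    · obtain ⟨x, hx, rfl⟩ := hKE.symm ▸ hy
      obtain ⟨⟨u, t⟩, hut⟩ := hT.2 ⟨x, hx⟩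
      refine ⟨t.1, ⟨t.1, t.2, rfl⟩, ?_⟩
      have h1 : (u.1 : G) * (t.1 : G) = x := congrArg Subtype.val hut
      have hu : π (u.1 : G) = 1 := hUR u.2
      rw [← h1, map_mul, hu, one_mul]
  · rw [Subgroup.card_map_of_injective K.subtype_injective, ← hT.symm.index_eq_card] at h
    exact hp.dvd_mul.1 (h.trans hidx)

theorem Subgroup.exists_dvd_card_of_dvd_card_pi {ι : Type*} [Finite ι] {S : ι → Type*}
    [∀ i, Group (S i)] [∀ i, Finite (S i)] (B : ∀ i, Subgroup (S i)) {p : ℕ} (hp : p.Prime)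
    (h : p ∣ Nat.card (Subgroup.pi Set.univ B)) : ∃ i, p ∣ Nat.card (B i) := by
  obtain ⟨x, hx⟩ := exists_prime_orderOf_dvd_card' p h (hp := ⟨hp⟩)
  have hx1 : (x.1 : ∀ i, S i) ≠ 1 := fun h1 => by
    rw [OneMemClass.coe_eq_one.1 h1, orderOf_one] at hx
    exact hp.one_lt.ne hx
  obtain ⟨i, hi⟩ := Function.ne_iff.1 hx1
  refine ⟨i, ?_⟩
  have hxi : (x : ∀ i, S i) i ∈ B i := x.2 i (Set.mem_univ i)
  have h1 : ((x : ∀ i, S i) i) ^ p = 1 := by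
    rw [← Pi.pow_apply, ← hx, ← Subgroup.coe_pow, pow_orderOf_eq_one]
    rfl
  rw [← orderOf_eq_prime h1 hi (hp := ⟨hp⟩)]
  exact Subgroup.orderOf_dvd_natCard _ hxi

section Product

variable {ι : Type*} [DecidableEq ι] {S : ι → Type u} [∀ i, Group (S i)] {E : Type v}

/-- The common fixed points in `E` of the elements `y j` of the factors indexed by `J`. -/
def fixedByFactors [Group E] (ρ : (∀ i, S i) →* MulAut E) (y : ∀ i, S i) (J : Finset ι) :
    Subgroup E where
  carrier := {m | ∀ j ∈ J, ρ (Pi.mulSingle j (y j)) m = m}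
  one_mem' := fun _ _ => map_one _
  mul_mem' := fun {a b} ha hb j hj => by rw [map_mul, ha j hj, hb j hj]
  inv_mem' := fun {a} ha j hj => by rw [map_inv, ha j hj]

theorem apply_mem_fixedByFactors [Group E] (ρ : (∀ i, S i) →* MulAut E) (y : ∀ i, S i)
    {J : Finset ι} {i : ι} (hi : i ∉ J) (s : S i) {m : E} (hm : m ∈ fixedByFactors ρ y J) :
    ρ (Pi.mulSingle i s) m ∈ fixedByFactors ρ y J := by
  intro j hj
  have hij : i ≠ j := fun h => hi (h ▸ hj)
  rw [← MulAut.mul_apply, ← map_mul, ← (Pi.mulSingle_commute hij s (y j)).eq, map_mul,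
    MulAut.mul_apply, hm j hj]

theorem exists_fixedByFactors_ne_bot [CommGroup E] [Finite E] [Nontrivial E]
    (ρ : (∀ i, S i) →* MulAut E) (q : ι → ℕ) (A : ∀ i, Subgroup (S i)) (J : Finset ι)
    (hq : ∀ i ∈ J, ¬ q i ∣ Nat.card E) (hA : ∀ i ∈ J, FixesCoprime.{u, v} (q i) (A i))
    (hfix : ∀ i ∈ J, ∀ m : E, (∀ s, ρ (Pi.mulSingle i s) m = m) → m = 1) :
    ∃ y : ∀ i, S i, (∀ i ∈ J, y i ∈ A i ∧ y i ≠ 1) ∧ fixedByFactors ρ y J ≠ ⊥ := by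
  induction J using Finset.induction_on with
  | empty =>
    refine ⟨1, by simp, ?_⟩
    have : fixedByFactors ρ 1 ∅ = ⊤ := eq_top_iff.2 fun m _ j hj => absurd hj (by simp)
    rw [this]
    exact top_ne_bot
  | insert i J hi ih =>
    obtain ⟨y, hy, hne⟩ := ih (fun j hj => hq j (Finset.mem_insert_of_mem hj))
      (fun j hj => hA j (Finset.mem_insert_of_mem hj))
      (fun j hj => hfix j (Finset.mem_insert_of_mem hj))
    have hiJ := Finset.mem_insert_self i J
    obtain ⟨z, hzA, hz1, m, hm, hm1, hzm⟩ := hA i hiJ E (ρ.comp (MonoidHom.mulSingle S i))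
      (fixedByFactors ρ y J) (hq i hiJ) hne
      (fun s m hm => apply_mem_fixedByFactors ρ y hi s hm) (fun m _ h => hfix i hiJ m h)
    refine ⟨Function.update y i z, fun j hj => ?_, fun h => hm1 ?_⟩
    · rcases eq_or_ne j i with rfl | hji
      · simp [hzA, hz1]
      · rw [Function.update_of_ne hji]
        exact hy j (Finset.mem_of_mem_insert_of_ne hj hji)
    · rw [← Subgroup.mem_bot, ← h]
      intro j hj
      rcases eq_or_ne j i with rfl | hji
      · rw [Function.update_self]
        exact hzm
      · rw [Function.update_of_ne hji]
        exact hm j (Finset.mem_of_mem_insert_of_ne hj hji)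

theorem exists_mem_fixedByFactors_ne [Group E] [∀ i, IsSimpleGroup (S i)]
    (ρ : (∀ i, S i) →* MulAut E) (y : ∀ i, S i) {J : Finset ι} (hJ : fixedByFactors ρ y J ≠ ⊥)
    {i : ι} (hi : i ∉ J) (hyi : y i ≠ 1)
    (hfix : ∀ m : E, (∀ s, ρ (Pi.mulSingle i s) m = m) → m = 1) :
    ∃ m ∈ fixedByFactors ρ y J, ρ (Pi.mulSingle i (y i)) m ≠ m := by
  by_contra! h
  refine hJ ((Subgroup.eq_bot_iff_forall _).2 fun m hm => hfix m fun s => ?_)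
  exact IsSimpleGroup.fixes_of_fixes (ρ.comp (MonoidHom.mulSingle S i))
    (fun s m hm => apply_mem_fixedByFactors ρ y hi s hm) hyi h s m hm

theorem exists_fixed_cosets_of_isChiefFactor {G : Type v} [Group G] [Finite G]
    [∀ i, IsSimpleGroup (S i)] (π : G →* ∀ i, S i) (hπ : Function.Surjective π)
    {M N : Subgroup G} [M.Normal] [N.Normal] (hMN : M < N) (hN : N ≤ π.ker)
    (hcomm : ⁅N, π.ker⁆ ≤ M) (q : ι → ℕ) (A : ∀ i, Subgroup (S i)) (J : Finset ι)
    (hq : ∀ i ∈ J, (q i).Prime ∧ ¬ q i ∣ Nat.card N)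
    (hA : ∀ i ∈ J, FixesCoprime.{u, v} (q i) (A i))
    (hfix : ∀ i ∈ J, ∀ x ∈ N, (∀ g s, π g = Pi.mulSingle i s → ⁅g, x⁆ ∈ M) → x ∈ M) :
    ∃ y : ∀ i, S i, (∀ i ∈ J, y i ∈ A i ∧ y i ≠ 1) ∧ ∀ J' ⊆ J, ∀ i ∈ J, i ∉ J' →
      ∃ x ∈ N, (∀ j ∈ J', ∀ g, π g = Pi.mulSingle j (y j) → ⁅g, x⁆ ∈ M) ∧
        ∀ g, π g = Pi.mulSingle i (y i) → ⁅g, x⁆ ∉ M := by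
  let mk := QuotientGroup.mk' M
  let E := N.map mk
  have hmk : ∀ g, mk g = 1 ↔ g ∈ M := fun g => QuotientGroup.eq_one_iff g
  have : E.Normal := Subgroup.Normal.map inferInstance mk (QuotientGroup.mk'_surjective M)
  let _ : CommGroup E := { (inferInstance : Group E) with
    mul_comm := by
      rintro ⟨_, a, ha, rfl⟩ ⟨_, b, hb, rfl⟩
      apply Subtype.ext
      change mk a * mk b = mk b * mk a
      rw [← commutatorElement_eq_one_iff_mul_comm, ← map_commutatorElement, hmk]
      exact hcomm (Subgroup.commutator_mem_commutator ha (hN hb)) }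
  let ρ₀ : G →* MulAut E := MulAut.conjNormal.comp mk
  have hρ₀ : ∀ g x (hx : x ∈ N), ρ₀ g ⟨mk x, x, hx, rfl⟩ = ⟨mk x, x, hx, rfl⟩ ↔ ⁅g, x⁆ ∈ M := by
    intro g x hx
    rw [Subtype.ext_iff, ← hmk, map_commutatorElement]
    change mk g * mk x * (mk g)⁻¹ = mk x ↔ mk g * mk x * (mk g)⁻¹ * (mk x)⁻¹ = 1
    rw [mul_inv_eq_one]
  have hker : π.ker ≤ ρ₀.ker := by
    intro r hr
    rw [MonoidHom.mem_ker]
    ext ⟨_, x, hx, rfl⟩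
    refine congrArg Subtype.val ((hρ₀ r x hx).2 ?_)
    rw [← commutatorElement_inv]
    exact inv_mem (hcomm (Subgroup.commutator_mem_commutator hx hr))
  let ρ : (∀ i, S i) →* MulAut E := π.liftOfSurjective hπ ⟨ρ₀, hker⟩
  have hρ : ∀ g, ρ (π g) = ρ₀ g := fun g => π.liftOfRightInverse_comp_apply _ _ ⟨ρ₀, hker⟩ g
  have hfixE : ∀ i ∈ J, ∀ m : E, (∀ s, ρ (Pi.mulSingle i s) m = m) → m = 1 := by
    rintro i hi ⟨_, x, hx, rfl⟩ h
    apply Subtype.ext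
    refine (hmk x).2 (hfix i hi x hx fun g s hg => (hρ₀ g x hx).1 ?_)
    rw [← hρ, hg]
    exact h s
  have : Nontrivial E := by
    rw [Subgroup.nontrivial_iff_ne_bot]
    intro h
    refine not_le_of_gt hMN fun x hx => (hmk x).1 ?_
    rw [← Subgroup.mem_bot, ← h]
    exact ⟨x, hx, rfl⟩
  obtain ⟨y, hy, hne⟩ := exists_fixedByFactors_ne_bot ρ q A J
    (fun i hi h => (hq i hi).2 (h.trans (Subgroup.card_map_dvd N mk))) hA hfixE
  refine ⟨y, hy, fun J' hJ' i hi hiJ' => ?_⟩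
  have hne' : fixedByFactors ρ y J' ≠ ⊥ := fun h =>
    hne (eq_bot_iff.2 (h ▸ fun m hm j hj => hm j (hJ' hj)))
  obtain ⟨⟨_, x, hx, rfl⟩, hxJ', hxi⟩ :=
    exists_mem_fixedByFactors_ne ρ y hne' hiJ' (hy i hi).2 (hfixE i hi)
  refine ⟨x, hx, fun j hj g hg => (hρ₀ g x hx).1 ?_, fun g hg h => hxi ?_⟩
  · rw [← hρ, hg]
    exact hxJ' j hj
  · rw [← hg, hρ]
    exact (hρ₀ g x hx).2 h

end Product

theorem Subgroup.commutator_le_of_isChiefFactor {G : Type*} [Group G] {R M N : Subgroup G}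
    [R.Normal] [M.Normal] [N.Normal] (hR : Group.IsNilpotent R) (hNR : N ≤ R) (hMN : M < N)
    (hmax : ∀ K : Subgroup G, K.Normal → M ≤ K → K ≤ N → K = M ∨ K = N) : ⁅N, R⁆ ≤ M := by
  rcases hmax (M ⊔ ⁅N, R⁆) inferInstance le_sup_left
    (sup_le hMN.le (Subgroup.commutator_le_left N R)) with h | h
  · exact sup_eq_left.1 h
  obtain ⟨c, hc⟩ := (Subgroup.isNilpotent_iff_lowerCentralSeries R).1 hR
  have hle : ∀ k, N ≤ M ⊔ R.lowerCentralSeries k := by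
    intro k
    induction k with
    | zero => exact hNR.trans le_sup_right
    | succ k ih =>
      rw [← h]
      refine sup_le le_sup_left (Subgroup.commutator_le.2 fun x hx r hr => ?_)
      obtain ⟨m, hm, y, hy, rfl⟩ := Subgroup.mem_sup_of_normal_left.1 (ih hx)
      rw [commutatorElement_mul_left_eq_conj_mul]
      have hmr : ⁅m, r⁆ ∈ M := Subgroup.commutator_le_left M R
        (Subgroup.commutator_mem_commutator hm hr)
      refine mul_mem (mul_mem (mul_mem (Subgroup.mem_sup_left hm) (Subgroup.mem_sup_right ?_))
        (inv_mem (Subgroup.mem_sup_left hm))) (Subgroup.mem_sup_left hmr)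
      exact Subgroup.commutator_mem_commutator hy hr
  have := hle c
  rw [hc, sup_bot_eq] at this
  exact absurd this (not_le_of_gt hMN)

theorem card_add_rank_le {G ι : Type*} [Group G] [DecidableEq ι] (h : Set G → ℕ)
    (hh : ∀ X Y, Subgroup.centralizer X < Subgroup.centralizer Y → h X < h Y) (d : ι → G)
    (X : Set G) (J : Finset ι)
    (hJ : ∀ J' ⊆ J, ∀ i ∈ J, i ∉ J' →
      ∃ g, (∀ x ∈ X, Commute x g) ∧ (∀ j ∈ J', Commute (d j) g) ∧ ¬ Commute (d i) g) :
    J.card + h (X ∪ d '' J) ≤ h X := by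
  induction J using Finset.induction_on with
  | empty => simp
  | insert i J hi ih =>
    have h1 := ih fun J' hJ' j hj hjJ => hJ J' (hJ'.trans (Finset.subset_insert i J)) j
      (Finset.mem_insert_of_mem hj) hjJ
    obtain ⟨g, hgX, hgJ, hgi⟩ := hJ J (Finset.subset_insert i J) i (Finset.mem_insert_self i J) hi
    have h2 : h (X ∪ d '' (insert i J : Finset ι)) < h (X ∪ d '' J) := by
      refine hh _ _ (lt_of_le_of_ne (Subgroup.centralizer_le ?_) fun heq => hgi ?_)
      · exact Set.union_subset_union_right X (Set.image_mono (by simp))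
      · have hg : g ∈ Subgroup.centralizer (X ∪ d '' J) := by
          rintro x (hx | ⟨j, hj, rfl⟩)
          · exact hgX x hx
          · exact hgJ j hj
        rw [← heq] at hg
        exact hg (d i) (Or.inr ⟨i, by simp, rfl⟩)
    rw [Finset.card_insert_of_notMem hi]
    omega

theorem Pi.range_mulSingle_normal {ι : Type*} [DecidableEq ι] {S : ι → Type*} [∀ i, Group (S i)]
    (i : ι) : (MonoidHom.mulSingle S i).range.Normal := by
  refine ⟨?_⟩
  rintro _ ⟨s, rfl⟩ f
  refine ⟨f i * s * (f i)⁻¹, ?_⟩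
  funext j
  rcases eq_or_ne j i with rfl | hji
  · simp
  · simp [hji]

theorem IsSimpleGroup.exists_commutator_not_commute {S : Type*} [Group S] [IsSimpleGroup S]
    (hS : ∃ a b : S, a * b ≠ b * a) {x : S} (hx : x ≠ 1) :
    ∃ a b : S, ¬ Commute x ⁅a, b⁆ := by
  by_contra! h
  have hle : commutator S ≤ Subgroup.centralizer {x} := by
    refine Subgroup.commutator_le.2 fun a _ b _ => ?_
    rw [Subgroup.mem_centralizer_singleton_iff]
    exact (h a b).eq.symm
  rcases (inferInstance : (commutator S).Normal).eq_bot_or_eq_top with h1 | h1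
  · obtain ⟨a, b, hab⟩ := hS
    refine hab (commutatorElement_eq_one_iff_mul_comm.1 ?_)
    rw [← Subgroup.mem_bot, ← h1]
    exact Subgroup.commutator_mem_commutator (Subgroup.mem_top a) (Subgroup.mem_top b)
  · rw [h1] at hle
    refine hx (Subgroup.mem_bot.1 (center_eq_bot hS ▸ Subgroup.mem_center_iff.2 fun g => ?_))
    exact Subgroup.mem_centralizer_singleton_iff.1 (hle (Subgroup.mem_top g))

theorem commutatorElement_mul_mul_of_commute {G : Type*} [Group G] {a b v w : G}
    (hvb : Commute v b) (hvw : Commute v w) (hwa : Commute w a) : ⁅a * v, b * w⁆ = ⁅a, b⁆ := by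
  calc ⁅a * v, b * w⁆ = a * (v * (b * w)) * v⁻¹ * a⁻¹ * (b * w)⁻¹ := by
        rw [commutatorElement_def]; group
    _ = a * b * (w * a⁻¹) * w⁻¹ * b⁻¹ := by rw [(hvb.mul_right hvw).eq]; group
    _ = ⁅a, b⁆ := by rw [hwa.inv_right.eq, commutatorElement_def]; group

theorem conj_mul_comm_of_commute {G : Type*} [Group G] {L T : Subgroup G} {Γ : Type*} [Group Γ]
    (π : G →* Γ) (hT : ∀ t ∈ T, π t = 1 → ∀ x ∈ L, Commute t x) {a b : G} (ha : a ∈ T) (hb : b ∈ T)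
    (hab : Commute (π a) (π b)) {x : G} (hx : x ∈ L) :
    a * b * x * (a * b)⁻¹ = b * a * x * (b * a)⁻¹ := by
  have h1 : Commute ((b * a)⁻¹ * (a * b)) x := by
    refine hT _ (mul_mem (inv_mem (mul_mem hb ha)) (mul_mem ha hb)) ?_ x hx
    rw [map_mul, map_inv, map_mul, map_mul, hab.eq, inv_mul_cancel]
  calc a * b * x * (a * b)⁻¹ = b * a * (((b * a)⁻¹ * (a * b)) * x) * (a * b)⁻¹ := by group
    _ = b * a * x * (b * a)⁻¹ := by rw [h1.eq]; group

section Chains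

variable {ι : Type*} [DecidableEq ι] {S : ι → Type u} [∀ i, Group (S i)]
  {G : Type v} [Group G] [Finite G] (π : G →* ∀ i, S i)

theorem mem_of_forall_commutator_mem {M N V T : Subgroup G} [M.Normal] [N.Normal]
    (hMN : M < N) (hNV : N ≤ V)
    (hmax : ∀ K : Subgroup G, K.Normal → M ≤ K → K ≤ N → K = M ∨ K = N)
    (hT : ∀ t ∈ T, π t = 1 → ∀ x ∈ V, Commute t x) {q : ℕ} (hq : q.Prime)
    (hqV : ¬ q ∣ Nat.card V) {i : ι} {A : Subgroup (S i)} (hA : IsPGroup q A) {t : G} (ht : t ∈ T)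
    {a : S i} (ha : a ∈ A) (hta : π t = Pi.mulSingle i a) (htM : ∀ m ∈ M, Commute t m)
    (htN : ∃ x ∈ N, ¬ Commute t x) {x : G} (hx : x ∈ N)
    (hfix : ∀ g s, π g = Pi.mulSingle i s → ⁅g, x⁆ ∈ M) : x ∈ M := by
  let mk := QuotientGroup.mk' M
  have hmk : ∀ g, mk g = 1 ↔ g ∈ M := fun g => QuotientGroup.eq_one_iff g
  have := Pi.range_mulSingle_normal (S := S) i
  let D : Subgroup G := (MonoidHom.mulSingle S i).range.comap π
  have : (D.map mk).Normal := Subgroup.Normal.map inferInstance mk (QuotientGroup.mk'_surjective M)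
  let B : Subgroup G := N ⊓ (Subgroup.centralizer (D.map mk : Set (G ⧸ M))).comap mk
  have hB : ∀ y, y ∈ B ↔ y ∈ N ∧ ∀ g s, π g = Pi.mulSingle i s → ⁅g, y⁆ ∈ M := by
    intro y
    refine and_congr_right fun hy => ⟨fun h g s hg => ?_, ?_⟩
    · rw [← hmk, map_commutatorElement, commutatorElement_eq_one_iff_mul_comm]
      exact h (mk g) ⟨g, ⟨s, hg.symm⟩, rfl⟩
    · rintro h _ ⟨g, ⟨s, hs⟩, rfl⟩
      rw [← commutatorElement_eq_one_iff_mul_comm, ← map_commutatorElement, hmk]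
      exact h g s hs.symm
  have hMB : M ≤ B := fun m hm => (hB m).2 ⟨hMN.le hm, fun g s _ =>
    mul_mem (‹M.Normal›.conj_mem m hm g) (inv_mem hm)⟩
  rcases hmax B inferInstance hMB inf_le_left with h | h
  · rw [← h]
    exact (hB x).2 ⟨hx, hfix⟩
  · obtain ⟨y, hyN, hy⟩ := htN
    obtain ⟨e, he⟩ := hA ⟨a, ha⟩
    have hae : a ^ q ^ e = 1 := congrArg Subtype.val he
    rw [← h] at hyN
    obtain ⟨m, hm, hmy⟩ := exists_common_fixed_in_coset M V (hMN.le.trans hNV) (fun _ : Unit => t)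
      (fun _ => q) (fun _ => e) {()}
      (fun _ _ => ⟨hq, fun h => hqV (h.trans (Subgroup.card_dvd_of_le (hMN.le.trans hNV)))⟩)
      (fun _ _ _ _ _ _ => rfl)
      (fun _ _ z hz => hT _ (pow_mem ht _)
        (by rw [map_pow, hta, ← Pi.mulSingle_pow, hae, Pi.mulSingle_one]) z hz) y
      (hNV ((hB y).1 hyN).1) (fun _ _ => ((hB y).1 hyN).2 t a hta)
    refine absurd ?_ hy
    have := (htM m hm).inv_right.mul_right (hmy () (by simp))
    rwa [inv_mul_cancel_left] at this

theorem card_filter_le_rank [∀ i, IsSimpleGroup (S i)] (hπ : Function.Surjective π)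
    (hnil : Group.IsNilpotent π.ker) {V T : Subgroup G}
    (hV : V ≤ π.ker) (hT : ∀ t ∈ T, π t = 1 → ∀ x ∈ V, Commute t x) (I : Finset ι) (q : ι → ℕ)
    (A : ∀ i, Subgroup (S i)) (hq : ∀ i ∈ I, (q i).Prime ∧ ¬ q i ∣ Nat.card V)
    (hAq : ∀ i ∈ I, IsPGroup (q i) (A i)) (hA : ∀ i ∈ I, FixesCoprime.{u, v} (q i) (A i))
    (hlift : ∀ i ∈ I, ∀ a ∈ A i, ∃ t ∈ T, π t = Pi.mulSingle i a) (h : Set G → ℕ)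
    (hh : ∀ X Y, Subgroup.centralizer X < Subgroup.centralizer Y → h X < h Y)
    (N : Subgroup G) [N.Normal] (hNV : N ≤ V) (X : Set G) (hX : ∀ x ∈ X, ∀ y ∈ N, Commute x y)
    [DecidablePred fun i => ∃ t ∈ T, (∃ a ∈ A i, π t = Pi.mulSingle i a) ∧ ∃ x ∈ N, ¬ Commute t x] :
    (I.filter fun i => ∃ t ∈ T, (∃ a ∈ A i, π t = Pi.mulSingle i a) ∧
      ∃ x ∈ N, ¬ Commute t x).card ≤ h X := by
  classical
  induction hn : Nat.card N using Nat.strong_induction_on generalizing N X with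
  | _ n ih =>
  let act (i : ι) (N : Subgroup G) : Prop :=
    ∃ t ∈ T, (∃ a ∈ A i, π t = Pi.mulSingle i a) ∧ ∃ x ∈ N, ¬ Commute t x
  change (I.filter fun i => act i N).card ≤ h X
  rcases eq_or_ne N ⊥ with rfl | hN
  · rw [Finset.filter_false_of_mem, Finset.card_empty]
    · exact Nat.zero_le _
    · rintro i - ⟨t, -, -, x, hx, htx⟩
      rw [Subgroup.mem_bot.1 hx] at htx
      exact htx (Commute.one_right t)
  obtain ⟨M, ⟨hMn, hMN⟩, hM⟩ := (Set.toFinite {K : Subgroup G | K.Normal ∧ K < N}).exists_maximal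
    ⟨⊥, inferInstance, bot_lt_iff_ne_bot.2 hN⟩
  have hmax : ∀ K : Subgroup G, K.Normal → M ≤ K → K ≤ N → K = M ∨ K = N := by
    intro K hK hMK hKN
    rcases hKN.eq_or_lt with h | h
    · exact Or.inr h
    · exact Or.inl (le_antisymm (hM ⟨hK, h⟩ hMK) hMK)
  let J := I.filter fun i => act i N ∧ ¬ act i M
  have hJI : ∀ i ∈ J, i ∈ I := fun i hi => (Finset.mem_filter.1 hi).1
  obtain ⟨y, hy, hmove⟩ := exists_fixed_cosets_of_isChiefFactor π hπ hMN (hNV.trans hV)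
    (Subgroup.commutator_le_of_isChiefFactor hnil (hNV.trans hV) hMN hmax) q A J
    (fun i hi => ⟨(hq i (hJI i hi)).1, fun h =>
      (hq i (hJI i hi)).2 (h.trans (Subgroup.card_dvd_of_le hNV))⟩)
    (fun i hi => hA i (hJI i hi)) (fun i hi x hx hfix => by
      obtain ⟨hiI, ⟨t, ht, ⟨a, ha, hta⟩, htN⟩, hiM⟩ := Finset.mem_filter.1 hi
      refine mem_of_forall_commutator_mem π hMN hNV hmax hT (hq i hiI).1 (hq i hiI).2
        (hAq i hiI) ht ha hta (fun m hm => ?_) htN hx hfix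
      by_contra hne
      exact hiM ⟨t, ht, ⟨a, ha, hta⟩, m, hm, hne⟩)
  have hd : ∀ i, ∃ t, i ∈ J → t ∈ T ∧ π t = Pi.mulSingle i (y i) := by
    intro i
    by_cases hi : i ∈ J
    · obtain ⟨t, ht⟩ := hlift i (hJI i hi) (y i) (hy i hi).1
      exact ⟨t, fun _ => ht⟩
    · exact ⟨1, fun h => absurd h hi⟩
  choose d hd using hd
  have he : ∀ i, ∃ e, i ∈ J → y i ^ q i ^ e = 1 := by
    intro i
    by_cases hi : i ∈ J
    · obtain ⟨e, he⟩ := hAq i (hJI i hi) ⟨y i, (hy i hi).1⟩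
      exact ⟨e, fun _ => congrArg Subtype.val he⟩
    · exact ⟨0, fun h => absurd h hi⟩
  choose e he using he
  have hsteps := card_add_rank_le h hh d X J (by
    intro J' hJ' i hi hiJ'
    obtain ⟨x, hxN, hxJ', hxi⟩ := hmove J' hJ' i hi hiJ'
    obtain ⟨m, hm, hfix⟩ := exists_common_fixed_in_coset M V (hMN.le.trans hNV) d q e J'
      (fun j hj => ⟨(hq j (hJI j (hJ' hj))).1, fun h => (hq j (hJI j (hJ' hj))).2
        (h.trans (Subgroup.card_dvd_of_le (hMN.le.trans hNV)))⟩)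
      (fun j hj l hl z hz => by
        rcases eq_or_ne j l with rfl | hjl
        · rfl
        refine conj_mul_comm_of_commute π hT (hd j (hJ' hj)).1 (hd l (hJ' hl)).1 ?_ hz
        rw [(hd j (hJ' hj)).2, (hd l (hJ' hl)).2]
        exact Pi.mulSingle_commute hjl _ _)
      (fun j hj z hz => hT _ (pow_mem (hd j (hJ' hj)).1 _)
        (by rw [map_pow, (hd j (hJ' hj)).2, ← Pi.mulSingle_pow, he j (hJ' hj), Pi.mulSingle_one])
        z hz) x (hNV hxN)
      (fun j hj => hxJ' j hj _ (hd j (hJ' hj)).2)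
    refine ⟨m * x, fun z hz => hX z hz _ (mul_mem (hMN.le hm) hxN), hfix, fun hcom => ?_⟩
    refine hxi (d i) (hd i hi).2 ?_
    have h1 : ⁅d i, x⁆ = d i * m⁻¹ * (d i)⁻¹ * m := by
      calc ⁅d i, x⁆ = d i * m⁻¹ * (m * x * (d i)⁻¹) * x⁻¹ := by rw [commutatorElement_def]; group
        _ = _ := by rw [hcom.symm.inv_right.eq]; group
    rw [h1]
    exact mul_mem (hMn.conj_mem _ (inv_mem hm) _) hm)
  have hrec : (I.filter fun i => act i M).card ≤ h (X ∪ d '' J) := by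
    refine ih (Nat.card M) ?_ M (hMN.le.trans hNV) _ ?_ rfl
    · rw [← hn]
      exact Set.Finite.card_lt_card (Set.toFinite _) hMN
    · rintro _ (hx | ⟨j, hj, rfl⟩) m hm
      · exact hX _ hx m (hMN.le hm)
      · by_contra hne
        exact (Finset.mem_filter.1 hj).2.2
          ⟨d j, (hd j hj).1, ⟨y j, (hy j hj).1, (hd j hj).2⟩, m, hm, hne⟩
  have hsub : (I.filter fun i => act i N) ⊆ J ∪ I.filter fun i => act i M := by
    intro i hi
    rw [Finset.mem_filter] at hi
    by_cases hiM : act i M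
    · exact Finset.mem_union_right _ (Finset.mem_filter.2 ⟨hi.1, hiM⟩)
    · exact Finset.mem_union_left _ (Finset.mem_filter.2 ⟨hi.1, hi.2, hiM⟩)
  have := (Finset.card_le_card hsub).trans (Finset.card_union_le _ _)
  omega

end Chains

theorem Nat.coprime_of_forall_prime {m n : ℕ} (P : Set ℕ) (hm : ∀ p, p.Prime → p ∣ m → p ∈ P)
    (hn : ∀ p, p.Prime → p ∣ n → p ∉ P) : m.Coprime n :=
  Nat.coprime_of_dvd fun p hp h1 h2 => hn p hp h2 (hm p hp h1)

section Chains

variable {ι : Type*} [Finite ι] [DecidableEq ι] {S : ι → Type u} [∀ i, Group (S i)]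
  {G : Type v} [Group G] (π : G →* ∀ i, S i)

theorem pi_le_map_of_mulSingle_mem (H : Subgroup G) (I : Finset ι) (B : ∀ i, Subgroup (S i))
    (h : ∀ i ∈ I, ∀ s ∈ B i, Pi.mulSingle i s ∈ H.map π) :
    Subgroup.pi Set.univ (fun i => if i ∈ I then B i else ⊥) ≤ H.map π := by
  intro f hf
  refine Subgroup.pi_mem_of_mulSingle_mem f fun i => ?_
  have hfi := hf i (Set.mem_univ i)
  by_cases hi : i ∈ I
  · simp only [hi, if_true] at hfi
    exact h i hi _ hfi
  · simp only [hi, if_false] at hfi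
    rw [show f i = 1 from hfi, Pi.mulSingle_one]
    exact one_mem _

theorem exists_complement_over_factors [Finite G] [∀ i, Finite (S i)] (P : Set ℕ)
    {U U' H : Subgroup G} [U.Normal]
    (hker : U ⊔ U' = π.ker) (hUH : U ≤ H) (hU : ∀ p, p.Prime → p ∣ Nat.card U → p ∈ P)
    (hU' : ∀ p, p.Prime → p ∣ Nat.card U' → p ∉ P)
    (hmem : ∀ x ∈ π.ker, (∀ p, p.Prime → p ∣ orderOf x → p ∉ P) → x ∈ U')
    (I : Finset ι) (q : ι → ℕ) (hq : ∀ i ∈ I, (q i).Prime ∧ q i ∉ P) (B : ∀ i, Subgroup (S i))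
    (hB : ∀ i ∈ I, IsPGroup (q i) (B i))
    (h : ∀ i ∈ I, ∀ s ∈ B i, Pi.mulSingle i s ∈ H.map π) :
    ∃ T ≤ H, (∀ t ∈ T, π t = 1 → t ∈ U') ∧
      ∀ i ∈ I, ∀ s ∈ B i, ∃ t ∈ T, π t = Pi.mulSingle i s := by
  let E := Subgroup.pi Set.univ (fun i => if i ∈ I then B i else ⊥)
  have hE : ∀ p, p.Prime → p ∣ Nat.card E → p ∉ P := by
    intro p hp hdvd
    obtain ⟨i, hi⟩ := Subgroup.exists_dvd_card_of_dvd_card_pi _ hp hdvd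
    by_cases hiI : i ∈ I
    · simp only [hiI, if_true] at hi
      have := Fact.mk (hq i hiI).1
      obtain ⟨n, hn⟩ := IsPGroup.iff_card.1 (hB i hiI)
      rw [hn] at hi
      rw [(Nat.prime_dvd_prime_iff_eq hp (hq i hiI).1).1 (hp.dvd_of_dvd_pow hi)]
      exact (hq i hiI).2
    · simp only [hiI, if_false, Subgroup.card_bot] at hi
      exact absurd (Nat.dvd_one.1 hi) hp.one_lt.ne'
  obtain ⟨T, hTH, hTE, hT⟩ := π.exists_complement_over U U' H hker hUH E
    (pi_le_map_of_mulSingle_mem π H I B h) (Nat.coprime_of_forall_prime P hU hU')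
    (Nat.coprime_of_forall_prime P hU hE)
  refine ⟨T, hTH, fun t ht hπt => hmem t hπt fun p hp hpt => ?_, fun i hi s hs => ?_⟩
  · exact (hT p hp (hpt.trans (Subgroup.orderOf_dvd_natCard T ht))).elim (hU' p hp) (hE p hp)
  · have : Pi.mulSingle i s ∈ E := by
      intro j _
      rcases eq_or_ne j i with rfl | hji
      · simpa [hi] using hs
      · change (Pi.mulSingle i s : ∀ i, S i) j ∈ (if j ∈ I then B j else ⊥)
        rw [Pi.mulSingle_eq_of_ne hji]
        exact one_mem _
    rw [← hTE] at this
    exact this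

theorem exists_card_add_rank_le [Finite G] [∀ i, Finite (S i)] [∀ i, IsSimpleGroup (S i)]
    (hS : ∀ i, ∃ a b : S i, a * b ≠ b * a) (P : Set ℕ) {V W : Subgroup G} [V.Normal] [W.Normal]
    (hker : W ⊔ V = π.ker) (hVW : W ≤ Subgroup.centralizer V)
    (hV : ∀ p, p.Prime → p ∣ Nat.card V → p ∈ P) (hW : ∀ p, p.Prime → p ∣ Nat.card W → p ∉ P)
    (hmem : ∀ x ∈ π.ker, (∀ p, p.Prime → p ∣ orderOf x → p ∈ P) → x ∈ V)
    (I : Finset ι) (p : ι → ℕ) (hp : ∀ i ∈ I, (p i).Prime ∧ p i ∈ P ∧ p i ∣ Nat.card (S i))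
    (hI : ∀ i ∈ I, ∀ s, Pi.mulSingle i s ∈ (Subgroup.centralizer (V : Set G)).map π)
    (h : Set G → ℕ) (hh : ∀ X Y, Subgroup.centralizer X < Subgroup.centralizer Y → h X < h Y) :
    ∃ X : Set G, X ⊆ Subgroup.centralizer (V : Set G) ∧ I.card + h X ≤ h ∅ := by
  have hx : ∀ i, ∃ x : S i, i ∈ I → orderOf x = p i := by
    intro i
    by_cases hi : i ∈ I
    · obtain ⟨x, hx⟩ := exists_prime_orderOf_dvd_card' (p i) (hp i hi).2.2 (hp := ⟨(hp i hi).1⟩)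
      exact ⟨x, fun _ => hx⟩
    · exact ⟨1, fun h => absurd h hi⟩
  choose x hx using hx
  obtain ⟨T, hTC, hT, hlift⟩ := exists_complement_over_factors π Pᶜ hker hVW hW
    (fun p hp h h' => h' (hV p hp h)) (fun x hx h => hmem x hx fun p hp h' => not_not.1 (h p hp h'))
    I p (fun i hi => ⟨(hp i hi).1, fun h => h (hp i hi).2.1⟩) (fun i => Subgroup.zpowers (x i))
    (fun i hi => IsPGroup.of_card (n := 1) (by rw [Nat.card_zpowers, hx i hi, pow_one]))
    (fun i hi s _ => hI i hi s)
  have hTcomm : ∀ t ∈ T, π t = 1 → ∀ y ∈ Subgroup.centralizer (V : Set G), Commute t y :=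
    fun t ht hπt y hy => hy t (hT t ht hπt)
  have hd : ∀ i, ∃ t, i ∈ I → t ∈ T ∧ π t = Pi.mulSingle i (x i) := by
    intro i
    by_cases hi : i ∈ I
    · obtain ⟨t, ht⟩ := hlift i hi (x i) (Subgroup.mem_zpowers _)
      exact ⟨t, fun _ => ht⟩
    · exact ⟨1, fun h => absurd h hi⟩
  choose d hd using hd
  refine ⟨d '' I, ?_, ?_⟩
  · rintro _ ⟨i, hi, rfl⟩
    exact hTC (hd i hi).1
  let mk := QuotientGroup.mk' W
  have hmk : ∀ g, mk g = 1 ↔ g ∈ W := fun g => QuotientGroup.eq_one_iff g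
  have hconj : ∀ t c, t ∈ Subgroup.centralizer (V : Set G) →
      c ∈ Subgroup.centralizer (V : Set G) → Commute (π t) (π c) →
      ∃ v ∈ V, v ∈ Subgroup.centralizer (V : Set G) ∧ mk (t * c * t⁻¹) = mk c * mk v := by
    intro t c ht hc htc
    have hz : c⁻¹ * (t * c * t⁻¹) ∈ W ⊔ V := by
      rw [hker, MonoidHom.mem_ker, map_mul, map_mul, map_mul, map_inv, map_inv, htc.eq]
      group
    obtain ⟨w, hw, v, hv, hwv⟩ := Subgroup.mem_sup_of_normal_left.1 hz
    refine ⟨v, hv, ?_, ?_⟩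
    · rw [eq_inv_mul_of_mul_eq hwv]
      exact mul_mem (inv_mem (hVW hw)) (mul_mem (inv_mem hc) (mul_mem (mul_mem ht hc) (inv_mem ht)))
    · rw [← one_mul (mk v), ← (hmk w).2 hw, ← map_mul mk w, hwv, ← map_mul, mul_inv_cancel_left]
  have hsteps := card_add_rank_le h hh d ∅ I (by
    intro J' hJ' i hi hiJ'
    have hxi : x i ≠ 1 := fun h1 => by
      have := hx i hi
      rw [h1, orderOf_one] at this
      exact (hp i hi).1.one_lt.ne this
    obtain ⟨s₁, s₂, hs⟩ := IsSimpleGroup.exists_commutator_not_commute (hS i) hxi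
    obtain ⟨c₁, hc₁, hπ₁⟩ := hI i hi s₁
    obtain ⟨c₂, hc₂, hπ₂⟩ := hI i hi s₂
    have hc : ⁅c₁, c₂⁆ ∈ Subgroup.centralizer (V : Set G) :=
      mul_mem (mul_mem (mul_mem hc₁ hc₂) (inv_mem hc₁)) (inv_mem hc₂)
    obtain ⟨m, hm, hfix⟩ := exists_common_fixed_in_coset W (Subgroup.centralizer V) hVW d p
      (fun _ => 1) J' (fun j hj => ⟨(hp j (hJ' hj)).1, fun h =>
        hW _ (hp j (hJ' hj)).1 h (hp j (hJ' hj)).2.1⟩)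
      (fun j hj l hl z hz => by
        rcases eq_or_ne j l with rfl | hjl
        · rfl
        refine conj_mul_comm_of_commute π hTcomm (hd j (hJ' hj)).1 (hd l (hJ' hl)).1 ?_ hz
        rw [(hd j (hJ' hj)).2, (hd l (hJ' hl)).2]
        exact Pi.mulSingle_commute hjl _ _)
      (fun j hj z hz => hTcomm _ (pow_mem (hd j (hJ' hj)).1 _)
        (by rw [map_pow, (hd j (hJ' hj)).2, ← Pi.mulSingle_pow, pow_one, ← hx j (hJ' hj),
          pow_orderOf_eq_one, Pi.mulSingle_one]) z hz) ⁅c₁, c₂⁆ hc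
      (fun j hj => by
        have hij : j ≠ i := fun h => hiJ' (h ▸ hj)
        have hdj := hTC (hd j (hJ' hj)).1
        obtain ⟨v, hv, hvC, hv'⟩ := hconj (d j) c₁ hdj hc₁ (by
          rw [(hd j (hJ' hj)).2, hπ₁]
          exact Pi.mulSingle_commute hij _ _)
        obtain ⟨w, hw, hwC, hw'⟩ := hconj (d j) c₂ hdj hc₂ (by
          rw [(hd j (hJ' hj)).2, hπ₂]
          exact Pi.mulSingle_commute hij _ _)
        rw [← hmk, map_mul, conjugate_commutatorElement, map_commutatorElement, hv', hw',
          commutatorElement_mul_mul_of_commute, ← map_commutatorElement, ← map_mul,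
          mul_inv_cancel, map_one]
        · exact Commute.map (hc₂ v hv) mk
        · exact Commute.map (hwC v hv) mk
        · exact Commute.map (hc₁ w hw) mk)
    refine ⟨m * ⁅c₁, c₂⁆, by simp, hfix, fun hcom => hs ?_⟩
    have h1 := hcom.map π
    have hm1 : π m = 1 := by
      rw [← MonoidHom.mem_ker, ← hker]
      exact Subgroup.mem_sup_left hm
    rw [(hd i hi).2, map_mul, hm1, one_mul, map_commutatorElement, hπ₁, hπ₂] at h1
    have h2 := h1.map (Pi.evalMonoidHom S i)
    simpa [map_commutatorElement] using h2)
  simpa using hsteps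

end Chains

/-- Let `G` be a finite group of `c`-dimension `k` whose soluble radical `R` (the largest
normal soluble subgroup of `G`) is nilpotent, and suppose that the quotient `G/R` is a
direct product of `n` nonabelian simple groups `S_1 × S_2 × ... × S_n`. Then `n ≤ 4k`. -/
theorem card_simple_factors_le_four_mul_cdim (G : Type*) [Group G] [Finite G]
    (k : ℕ) (hk : HasCDimension G k)
    (R : Subgroup G) [R.Normal] (hsol : IsSolvable R)
    (hrad : ∀ M : Subgroup G, M.Normal → IsSolvable M → M ≤ R)
    (hnilp : Group.IsNilpotent R)
    (n : ℕ) (S : Fin n → Type*) [∀ i, Group (S i)] [∀ i, IsSimpleGroup (S i)]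
    (hnonab : ∀ i, ∃ a b : S i, a * b ≠ b * a)
    (e : (G ⧸ R) ≃* ∀ i, S i) :
    n ≤ 4 * k := by
  classical
  let π : G →* ∀ i, S i := e.toMonoidHom.comp (QuotientGroup.mk' R)
  have hπ : Function.Surjective π := e.surjective.comp (QuotientGroup.mk'_surjective R)
  have hR : π.ker = R := by
    ext g
    rw [MonoidHom.mem_ker, ← QuotientGroup.eq_one_iff g]
    exact map_eq_one_iff e e.injective
  have hfin : ∀ i, Finite (S i) := fun i =>
    Finite.of_surjective (fun g => π g i) ((Function.surjective_eval i).comp hπ)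
  choose q hq A hA1 hAq hA using fun i => IsSimpleGroup.exists_fixesCoprime (S i) (hnonab i)
  choose p hp hpq hpS using fun i =>
    IsSimpleGroup.exists_prime_ne_dvd_card (S i) (hnonab i) (hq i)
  obtain ⟨P, hP⟩ := exists_quarter_cut p q hpq
  rw [Fintype.card_fin] at hP
  refine hP.trans (Nat.mul_le_mul_left 4 ?_)
  obtain ⟨h, hhk, hh⟩ := exists_centralizer_rank hk.2
  rw [← hR] at hnilp
  obtain ⟨V, hVn, hVR, hV, hVmem⟩ := π.ker.exists_normal_hall hnilp P
  obtain ⟨W, hWn, hWR, hW, hWmem⟩ := π.ker.exists_normal_hall hnilp (P : Set ℕ)ᶜ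
  have hcop : (Nat.card V).Coprime (Nat.card W) := Nat.coprime_of_forall_prime P hV hW
  have hVW : W ≤ Subgroup.centralizer V := fun w hw v hv =>
    Subgroup.commute_of_normal_of_disjoint V W hVn hWn
      (Subgroup.disjoint_of_coprime_natCard hcop) v w hv hw
  have hsup : W ⊔ V = π.ker := by
    refine Subgroup.sup_eq_of_forall_pgroup_mem (sup_le hWR hVR) fun r _ x hx hxr => ?_
    by_cases hr : r ∈ P
    · exact Subgroup.mem_sup_right (hVmem x hx fun l hl hlx => hxr l hl hlx ▸ hr)
    · exact Subgroup.mem_sup_left (hWmem x hx fun l hl hlx => hxr l hl hlx ▸ hr)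
  let I := Finset.univ.filter fun i => p i ∈ P ∧ q i ∉ P
  let D := (Subgroup.centralizer (V : Set G)).map π
  have hDn : D.Normal := Subgroup.Normal.map inferInstance π hπ
  let I₁ := I.filter fun i => ¬ ∀ s, Pi.mulSingle i s ∈ D
  let I₂ := I.filter fun i => ∀ s, Pi.mulSingle i s ∈ D
  have hI : ∀ i ∈ I, p i ∈ P ∧ q i ∉ P := fun i hi => (Finset.mem_filter.1 hi).2
  have hI₁ : ∀ i ∈ I₁, i ∈ I := fun i hi => (Finset.mem_filter.1 hi).1
  obtain ⟨X, hXV, hX⟩ := exists_card_add_rank_le π hnonab P hsup hVW hV hW hVmem I₂ p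
    (fun i hi => ⟨hp i, (hI i (Finset.mem_filter.1 hi).1).1, hpS i⟩)
    (fun i hi => (Finset.mem_filter.1 hi).2) h hh
  obtain ⟨T, -, hT, hlift⟩ := exists_complement_over_factors π P ((sup_comm V W).trans hsup) le_top
    hV hW hWmem I₁ q (fun i hi => ⟨hq i, (hI i (hI₁ i hi)).2⟩) A (fun i _ => hAq i)
    (fun i _ s _ => by
      rw [← MonoidHom.range_eq_map, MonoidHom.range_eq_top.2 hπ]
      exact Subgroup.mem_top _)
  have hle := card_filter_le_rank π hπ hnilp hVR
    (fun t ht hπt y hy => (hVW (hT t ht hπt) y hy).symm) I₁ q A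
    (fun i hi => ⟨hq i, fun h => (hI i (hI₁ i hi)).2 (hV _ (hq i) h)⟩) (fun i _ => hAq i)
    (fun i _ => hA i) hlift h hh V le_rfl X (fun x hx y hy => (hXV hx y hy).symm)
  rw [Finset.filter_true_of_mem] at hle
  · have hcard : I₂.card + I₁.card = I.card := Finset.card_filter_add_card_filter_not _
    have := hhk ∅
    change I.card ≤ k
    omega
  · intro i hi
    obtain ⟨⟨a, ha⟩, ha1⟩ := Subgroup.ne_bot_iff_exists_ne_one.1 (hA1 i)
    obtain ⟨t, ht, hta⟩ := hlift i hi a ha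
    refine ⟨t, ht, ⟨a, ha, hta⟩, ?_⟩
    by_contra! hcom
    refine (Finset.mem_filter.1 hi).2 fun s => ?_
    have hmem : a ∈ D.comap (MonoidHom.mulSingle S i) := ⟨t, fun y hy => (hcom y hy).symm, hta⟩
    rcases (hDn.comap (MonoidHom.mulSingle S i)).eq_bot_or_eq_top with h1 | h1
    · rw [h1, Subgroup.mem_bot] at hmem
      exact absurd (Subtype.ext hmem) ha1
    · exact (h1 ▸ Subgroup.mem_top s : s ∈ D.comap (MonoidHom.mulSingle S i))
end
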